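/- arXiv:2110.09261 — 2 statements merged into one kernel-verified Lean document; each statement's English description precedes it below -/
import Mathlib

section
/- Let Ω̃ ⊂ ℝⁿ be a bounded domain such that there exists a weak (p,q)-quasiconformal mapping φ: Ω → Ω̃, 1 ≤ q ≤ p ≤ n, from a bounded (s,q)-Sobolev–Poincaré domain Ω ⊂ ℝⁿ onto Ω̃, with q < s. Then the weighted Poincaré inequality inf_{c∈ℝ} (∫_{Ω̃} |f(y) − c|^s w(y) dy)^{1/s} ≤ B^w_{s,p}(Ω̃) (∫_{Ω̃} |∇f(y)|^p dy)^{1/p} holds for every f ∈ W¹ₚ(Ω̃), with weight w(y) = J_{φ⁻¹}(y), where B^w_{s,p}(Ω̃) = B_{s,q}(Ω)·K_{p,q}(Ω;φ). -/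
open MeasureTheory ENNReal Set Filter
open scoped RealInnerProductSpace

noncomputable section

attribute [local instance] Classical.propDecidable

/-- Euclidean space `ℝⁿ`. -/
abbrev Euc (n : ℕ) := EuclideanSpace ℝ (Fin n)

/-- A (parametrized) curve in `ℝⁿ`: a function considered on a compact interval `[a,b]`. -/
structure Curve (n : ℕ) where
  a : ℝ
  b : ℝ
  hab : a ≤ b
  toFun : ℝ → Euc n

namespace Curve

variable {n : ℕ}

/-- The curve lies in the set `Ω`. -/
def In (γ : Curve n) (Ω : Set (Euc n)) : Prop :=
  ∀ t ∈ Icc γ.a γ.b, γ.toFun t ∈ Ω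

/-- The curve is a (continuous) path. -/
def IsPath (γ : Curve n) : Prop := ContinuousOn γ.toFun (Icc γ.a γ.b)

/-- The curve is rectifiable: it has finite length (total variation). -/
def Rectifiable (γ : Curve n) : Prop := eVariationOn γ.toFun (Icc γ.a γ.b) < ⊤

/-- `c : [0,l] → ℝⁿ` is a unit-speed (arclength) reparametrization of the curve `γ`. -/
def IsArclengthParam (γ : Curve n) (l : ℝ) (c : ℝ → Euc n) : Prop :=
  0 ≤ l ∧ (∀ t ∈ Icc (0:ℝ) l, eVariationOn c (Icc 0 t) = ENNReal.ofReal t) ∧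
  ∃ σ : ℝ → ℝ, MonotoneOn σ (Icc γ.a γ.b) ∧ σ γ.a = 0 ∧ σ γ.b = l ∧
    (∀ t ∈ Icc γ.a γ.b, σ t ∈ Icc 0 l) ∧ ∀ t ∈ Icc γ.a γ.b, γ.toFun t = c (σ t)

/-- The line integral `∫_γ ρ ds`, computed through an arclength parametrization of `γ`
(equal to `∞` if no arclength parametrization exists, e.g. for non-rectifiable curves). -/
def lineIntegral (γ : Curve n) (ρ : Euc n → ℝ≥0∞) : ℝ≥0∞ :=
  ⨅ (l : ℝ) (c : ℝ → Euc n) (_ : γ.IsArclengthParam l c),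
    ∫⁻ t in Icc (0:ℝ) l, ρ (c t)

/-- The image curve `φ ∘ γ`. -/
def map (γ : Curve n) (φ : Euc n → Euc n) : Curve n :=
  ⟨γ.a, γ.b, γ.hab, φ ∘ γ.toFun⟩

end Curve

/-- `ρ` is an admissible (non-negative Borel) function for the curve family `Γ`:
`∫_γ ρ ds ≥ 1` for every (locally) rectifiable `γ ∈ Γ`. -/
def IsAdmissible {n : ℕ} (Γ : Set (Curve n)) (ρ : Euc n → ℝ≥0∞) : Prop :=
  Measurable ρ ∧ ∀ γ ∈ Γ, γ.Rectifiable → 1 ≤ γ.lineIntegral ρ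

/-- The conformal modulus `M(Γ)` of a family of curves in `ℝⁿ`. -/
def modulus {n : ℕ} (Γ : Set (Curve n)) : ℝ≥0∞ :=
  ⨅ (ρ : Euc n → ℝ≥0∞) (_ : IsAdmissible Γ ρ), ∫⁻ x, ρ x ^ (n : ℝ)

/-- `φ` is a homeomorphism of `Ω` onto `Ω'`. -/
def IsHomeoOn {n : ℕ} (φ : Euc n → Euc n) (Ω Ω' : Set (Euc n)) : Prop :=
  Set.BijOn φ Ω Ω' ∧ ContinuousOn φ Ω ∧ ContinuousOn (Function.invFunOn φ Ω) Ω'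

/-- `φ : Ω → Ω'` is a `Q`-homeomorphism: `M(φΓ) ≤ ∫_Ω Q ρⁿ` for every family `Γ` of
rectifiable paths in `Ω` and every admissible function `ρ` for `Γ`. -/
def IsQHomeo {n : ℕ} (φ : Euc n → Euc n) (Ω Ω' : Set (Euc n)) (Q : Euc n → ℝ≥0∞) : Prop :=
  IsHomeoOn φ Ω Ω' ∧ Measurable Q ∧
  ∀ Γ : Set (Curve n), (∀ γ ∈ Γ, γ.In Ω ∧ γ.IsPath ∧ γ.Rectifiable) →
    ∀ ρ : Euc n → ℝ≥0∞, IsAdmissible Γ ρ →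
      modulus ((fun γ => γ.map φ) '' Γ) ≤ ∫⁻ x in Ω, Q x * ρ x ^ (n : ℝ)

/-- `g` is a weak gradient of the scalar function `f` on `Ω` (integration by parts against
smooth compactly supported test functions). -/
def HasWeakGradientOn {n : ℕ} (f : Euc n → ℝ) (g : Euc n → Euc n) (Ω : Set (Euc n)) : Prop :=
  LocallyIntegrableOn f Ω ∧ LocallyIntegrableOn g Ω ∧
  ∀ η : Euc n → ℝ, ContDiff ℝ (⊤ : ℕ∞) η → HasCompactSupport η → tsupport η ⊆ Ω →
    ∀ v : Euc n, ∫ x in Ω, f x * fderiv ℝ η x v = - ∫ x in Ω, ⟪g x, v⟫ * η x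

/-- `D` is a weak differential of the mapping `φ : Ω → ℝⁿ`. -/
def HasWeakDerivOn {n : ℕ} (φ : Euc n → Euc n) (D : Euc n → Euc n →L[ℝ] Euc n)
    (Ω : Set (Euc n)) : Prop :=
  LocallyIntegrableOn φ Ω ∧ LocallyIntegrableOn D Ω ∧
  ∀ η : Euc n → ℝ, ContDiff ℝ (⊤ : ℕ∞) η → HasCompactSupport η → tsupport η ⊆ Ω →
    ∀ v : Euc n, ∫ x in Ω, fderiv ℝ η x v • φ x = - ∫ x in Ω, η x • D x v

/-- The Jacobian `J(x,φ) = det Dφ(x)`. -/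
def jacobian {n : ℕ} (D : Euc n → Euc n →L[ℝ] Euc n) (x : Euc n) : ℝ :=
  LinearMap.det (D x : Euc n →ₗ[ℝ] Euc n)

/-- `φ` (with weak differential `D`) has finite distortion on `Ω`:
`Dφ(x) = 0` a.e. on the zero set of the Jacobian. -/
def FiniteDistortionOn {n : ℕ} (D : Euc n → Euc n →L[ℝ] Euc n) (Ω : Set (Euc n)) : Prop :=
  ∀ᵐ x ∂(volume.restrict Ω), jacobian D x = 0 → D x = 0

/-- The `L_p`-norm (`p ∈ (0,∞]`) of an `ℝ≥0∞`-valued function. -/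
def lpNormE {n : ℕ} (f : Euc n → ℝ≥0∞) (p : ℝ≥0∞) (μ : Measure (Euc n)) : ℝ≥0∞ :=
  if p = ∞ then essSup f μ else (∫⁻ x, f x ^ p.toReal ∂μ) ^ (1 / p.toReal)

/-- `ψ : Ω → Ω'` generates, by the composition rule `f ↦ f ∘ ψ`, a bounded composition
operator `L¹_p(Ω') → L¹_q(Ω)` with constant `K`. -/
def IsCompOpBddWith {n : ℕ} (Ω Ω' : Set (Euc n)) (ψ : Euc n → Euc n) (p q K : ℝ≥0∞) : Prop :=
  ∀ (f : Euc n → ℝ) (gf : Euc n → Euc n), HasWeakGradientOn f gf Ω' →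
    lpNormE (fun x => (‖gf x‖₊ : ℝ≥0∞)) p (volume.restrict Ω') ≠ ∞ →
    ∃ g : Euc n → Euc n, HasWeakGradientOn (f ∘ ψ) g Ω ∧
      lpNormE (fun x => (‖g x‖₊ : ℝ≥0∞)) q (volume.restrict Ω) ≤
        K * lpNormE (fun x => (‖gf x‖₊ : ℝ≥0∞)) p (volume.restrict Ω')

/-- `ψ : Ω → Ω'` generates a bounded composition operator `L¹_p(Ω') → L¹_q(Ω)`. -/
def IsCompOpBdd {n : ℕ} (Ω Ω' : Set (Euc n)) (ψ : Euc n → Euc n) (p q : ℝ≥0∞) : Prop :=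
  ∃ K : ℝ≥0∞, K ≠ ∞ ∧ IsCompOpBddWith Ω Ω' ψ p q K

/-- The volume derivative `J_{φ⁻¹}(y) = lim_{r→0} |φ⁻¹(B(y,r))| / |B(y,r)|`
(as a limsup, so that it is everywhere defined). -/
def volDerivInv {n : ℕ} (φ : Euc n → Euc n) (Ω : Set (Euc n)) (y : Euc n) : ℝ≥0∞ :=
  limsup (fun r : ℝ => volume (Ω ∩ φ ⁻¹' Metric.ball y r) / volume (Metric.ball y r))
    (nhdsWithin 0 (Ioi 0))

/-- The distortion function `H_q(y) = (|Dφ(x)|^q/|J(x,φ)|)^{1/q}` at `x = φ⁻¹(y)` outside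
the singular set `S` and the zero set of the Jacobian, and `0` otherwise. -/
def distortionH {n : ℕ} (D : Euc n → Euc n →L[ℝ] Euc n) (φ : Euc n → Euc n)
    (Ω S : Set (Euc n)) (q : ℝ) (y : Euc n) : ℝ≥0∞ :=
  if Function.invFunOn φ Ω y ∈ Ω \ (S ∪ {x | jacobian D x = 0}) then
    ((‖D (Function.invFunOn φ Ω y)‖₊ : ℝ≥0∞) ^ q /
      ENNReal.ofReal |jacobian D (Function.invFunOn φ Ω y)|) ^ (1 / q)
  else 0

/-- The `p`-dilatation `K_p(x) = inf {k : |Dφ(x)| ≤ k |J(x,φ)|^{1/p}}`. -/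
def dilK {n : ℕ} (p : ℝ≥0∞) (D : Euc n → Euc n →L[ℝ] Euc n) (x : Euc n) : ℝ≥0∞ :=
  (‖D x‖₊ : ℝ≥0∞) / (ENNReal.ofReal |jacobian D x|) ^ (1/p).toReal

/-- Local `L_q`-integrability of the weak differential on `Ω`
(the differential part of `φ ∈ W¹_{q,loc}(Ω)`). -/
def MemWlocOn {n : ℕ} (D : Euc n → Euc n →L[ℝ] Euc n) (q : ℝ≥0∞) (Ω : Set (Euc n)) : Prop :=
  ∀ K : Set (Euc n), K ⊆ Ω → IsCompact K →
    lpNormE (fun x => (‖D x‖₊ : ℝ≥0∞)) q (volume.restrict K) ≠ ∞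

/-- Minimal stretch `l(T) = min {|T h| : |h| = 1}`. -/
def minStretch {n : ℕ} (T : Euc n →L[ℝ] Euc n) : ℝ :=
  ⨅ h : {h : Euc n // ‖h‖ = 1}, ‖T h.1‖

/-- The inner conformal dilatation `K^I(x,φ) = |J(x,φ)| / l(Dφ(x))ⁿ` (and `0` when
`J(x,φ) = 0`). -/
def innerDil {n : ℕ} (D : Euc n → Euc n →L[ℝ] Euc n) (x : Euc n) : ℝ≥0∞ :=
  if jacobian D x = 0 then 0
  else ENNReal.ofReal (|jacobian D x| / minStretch (D x) ^ n)

/-- `Ω` is an `(s,q)`-Sobolev–Poincaré domain with constant `B`. -/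
def IsSobolevPoincare {n : ℕ} (Ω : Set (Euc n)) (s q : ℝ) (B : ℝ≥0∞) : Prop :=
  ∀ (g : Euc n → ℝ) (gg : Euc n → Euc n), HasWeakGradientOn g gg Ω →
    ⨅ c : ℝ, (∫⁻ x in Ω, (‖g x - c‖₊ : ℝ≥0∞) ^ s) ^ (1/s) ≤
      B * (∫⁻ x in Ω, (‖gg x‖₊ : ℝ≥0∞) ^ q) ^ (1/q)

/-- `Ω` is a domain: an open connected set. -/
def IsDomainIn {n : ℕ} (Ω : Set (Euc n)) : Prop := IsOpen Ω ∧ IsConnected Ω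

/-- The mapping satisfies the Luzin `N`-property on `Ω`. -/
def LuzinN {n : ℕ} (φ : Euc n → Euc n) (Ω : Set (Euc n)) : Prop :=
  ∀ A ⊆ Ω, volume A = 0 → volume (φ '' A) = 0

/-- The volume derivative of the inverse mapping is a.e. bounded by the Radon–Nikodym derivative
of the push-forward of Lebesgue measure on `Ω`. -/
lemma volDerivInv_le_rnDeriv {n : ℕ} {φ : Euc n → Euc n} {Ω : Set (Euc n)}
    (hΩ : MeasurableSet Ω) (hΩfin : volume Ω ≠ ∞) (hφ : AEMeasurable φ (volume.restrict Ω)) :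
    ∀ᵐ y, volDerivInv φ Ω y ≤ (Measure.map φ (volume.restrict Ω)).rnDeriv volume y := by
  have : IsFiniteMeasure (volume.restrict Ω) := ⟨by simpa using hΩfin.lt_top⟩
  filter_upwards [Besicovitch.ae_tendsto_rnDeriv (Measure.map φ (volume.restrict Ω))
    (volume : Measure (Euc n))] with y hy
  rw [← hy.limsup_eq]
  refine limsup_le_limsup ?_
  filter_upwards [self_mem_nhdsWithin] with r hr
  have hr0 : r ≠ 0 := (mem_Ioi.mp hr).ne'
  have hball : volume (Metric.closedBall y r) = volume (Metric.ball y r) := by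
    have hae := union_ae_eq_left_of_ae_eq_empty (s := Metric.ball y r)
      (ae_eq_empty.mpr (Measure.addHaar_sphere_of_ne_zero volume y hr0))
    rw [← Metric.ball_union_sphere, measure_congr hae]
  rw [hball]
  refine ENNReal.div_le_div_right ?_ _
  calc volume (Ω ∩ φ ⁻¹' Metric.ball y r)
      = Measure.map φ (volume.restrict Ω) (Metric.ball y r) := by
        rw [Measure.map_apply_of_aemeasurable hφ measurableSet_ball,
          Measure.restrict_apply' hΩ, inter_comm]
    _ ≤ _ := measure_mono Metric.ball_subset_closedBall

/-- Change of variables inequality for the volume derivative of the inverse mapping. No Luzin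
property is needed, and `h` is only assumed to be a.e. measurable. -/
lemma setLIntegral_mul_volDerivInv_le {n : ℕ} {φ : Euc n → Euc n} {Ω Ω' : Set (Euc n)}
    (hΩ : MeasurableSet Ω) (hΩfin : volume Ω ≠ ∞) (hφ : AEMeasurable φ (volume.restrict Ω))
    (hΩ' : MeasurableSet Ω') {h : Euc n → ℝ≥0∞} (hh : AEMeasurable h (volume.restrict Ω')) :
    ∫⁻ y in Ω', h y * volDerivInv φ Ω y ≤ ∫⁻ x in Ω, h (φ x) := by
  have : IsFiniteMeasure (volume.restrict Ω) := ⟨by simpa using hΩfin.lt_top⟩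
  set ρ := Measure.map φ (volume.restrict Ω)
  have hnull : volume {y | ¬ (y ∈ Ω' → h y = hh.mk h y)} = 0 :=
    (ae_restrict_iff' hΩ').mp hh.ae_eq_mk
  obtain ⟨N, hsub, hNm, hN⟩ := exists_measurable_superset_of_null hnull
  have heq : ∀ y ∈ Ω' \ N, hh.mk h y = h y := fun y hy => by
    by_contra hne
    exact hy.2 (hsub fun H => hne (H hy.1).symm)
  have hFm : Measurable ((Ω' \ N).indicator (hh.mk h)) :=
    hh.measurable_mk.indicator (hΩ'.diff hNm)
  have hFle : ∀ y, (Ω' \ N).indicator (hh.mk h) y ≤ h y := fun y => by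
    by_cases hy : y ∈ Ω' \ N
    · rw [indicator_of_mem hy, heq y hy]
    · rw [indicator_of_notMem hy]
      exact zero_le
  calc ∫⁻ y in Ω', h y * volDerivInv φ Ω y
      ≤ ∫⁻ y in Ω', ρ.rnDeriv volume y * (Ω' \ N).indicator (hh.mk h) y := by
        refine lintegral_mono_ae ((ae_restrict_iff' hΩ').mpr ?_)
        filter_upwards [volDerivInv_le_rnDeriv hΩ hΩfin hφ,
          measure_eq_zero_iff_ae_notMem.mp hN] with y hy hyN hyΩ
        have hyd : y ∈ Ω' \ N := ⟨hyΩ, hyN⟩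
        rw [indicator_of_mem hyd, heq y hyd, mul_comm]
        gcongr
    _ ≤ ∫⁻ y, ρ.rnDeriv volume y * (Ω' \ N).indicator (hh.mk h) y := setLIntegral_le_lintegral _ _
    _ = ∫⁻ y, (Ω' \ N).indicator (hh.mk h) y ∂(volume.withDensity (ρ.rnDeriv volume)) :=
        (lintegral_withDensity_eq_lintegral_mul _ (Measure.measurable_rnDeriv _ _) hFm).symm
    _ ≤ ∫⁻ y, (Ω' \ N).indicator (hh.mk h) y ∂ρ :=
        lintegral_mono' (Measure.withDensity_rnDeriv_le _ _) le_rfl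
    _ = ∫⁻ x in Ω, (Ω' \ N).indicator (hh.mk h) (φ x) := lintegral_map' hFm.aemeasurable hφ
    _ ≤ ∫⁻ x in Ω, h (φ x) := lintegral_mono fun x => hFle _

theorem statement_2 (n : ℕ) (hn : 1 ≤ n) (Ω Ω' : Set (Euc n))
    (hΩ : IsDomainIn Ω) (hΩb : Bornology.IsBounded Ω)
    (hΩ' : IsDomainIn Ω') (hΩ'b : Bornology.IsBounded Ω')
    (p q s : ℝ) (hq : 1 ≤ q) (hqp : q ≤ p) (hpn : p ≤ n) (hqs : q < s)
    (φ : Euc n → Euc n) (hφ : IsHomeoOn φ Ω Ω')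
    (K B : ℝ≥0∞) (hK : K ≠ ∞) (hB : B ≠ ∞)
    (hcomp : IsCompOpBddWith Ω Ω' φ (ENNReal.ofReal p) (ENNReal.ofReal q) K)
    (hSP : IsSobolevPoincare Ω s q B)
    (f : Euc n → ℝ) (gf : Euc n → Euc n)
    (hf : HasWeakGradientOn f gf Ω')
    (hfLp : (∫⁻ y in Ω', (‖f y‖₊ : ℝ≥0∞) ^ p) ≠ ∞)
    (hgfLp : (∫⁻ y in Ω', (‖gf y‖₊ : ℝ≥0∞) ^ p) ≠ ∞) :
    ⨅ c : ℝ, (∫⁻ y in Ω', (‖f y - c‖₊ : ℝ≥0∞) ^ s * volDerivInv φ Ω y) ^ (1/s) ≤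
      B * K * (∫⁻ y in Ω', (‖gf y‖₊ : ℝ≥0∞) ^ p) ^ (1/p) := by
  have hp0 : 0 ≤ p := by linarith
  have hq0 : 0 ≤ q := by linarith
  have hs0 : 0 ≤ 1 / s := one_div_nonneg.mpr (by linarith)
  have hnorm : ∀ (u : Euc n → ℝ≥0∞) (r : ℝ) (μ : Measure (Euc n)), 0 ≤ r →
      lpNormE u (ENNReal.ofReal r) μ = (∫⁻ x, u x ^ r ∂μ) ^ (1 / r) := fun u r μ hr => by
    rw [lpNormE, if_neg ENNReal.ofReal_ne_top, ENNReal.toReal_ofReal hr]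
  obtain ⟨g, hg, hgK⟩ := hcomp f gf hf <| by
    rw [hnorm _ _ _ hp0]
    exact ENNReal.rpow_ne_top_of_nonneg (one_div_nonneg.mpr hp0) hgfLp
  rw [hnorm _ _ _ hp0, hnorm _ _ _ hq0] at hgK
  have hΩm := hΩ.1.measurableSet
  have hfm : AEMeasurable f (volume.restrict Ω') := hf.1.aestronglyMeasurable.aemeasurable
  calc ⨅ c : ℝ, (∫⁻ y in Ω', (‖f y - c‖₊ : ℝ≥0∞) ^ s * volDerivInv φ Ω y) ^ (1/s)
      ≤ ⨅ c : ℝ, (∫⁻ x in Ω, (‖(f ∘ φ) x - c‖₊ : ℝ≥0∞) ^ s) ^ (1/s) :=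
        iInf_mono fun c => ENNReal.rpow_le_rpow
          (setLIntegral_mul_volDerivInv_le (h := fun y => (‖f y - c‖₊ : ℝ≥0∞) ^ s) hΩm
            hΩb.measure_lt_top.ne (hφ.2.1.aemeasurable hΩm) hΩ'.1.measurableSet
            ((hfm.sub_const c).enorm.pow_const s)) hs0
    _ ≤ B * (∫⁻ x in Ω, (‖g x‖₊ : ℝ≥0∞) ^ q) ^ (1/q) := hSP _ _ hg
    _ ≤ B * (K * (∫⁻ y in Ω', (‖gf y‖₊ : ℝ≥0∞) ^ p) ^ (1/p)) := by gcongr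
    _ = B * K * (∫⁻ y in Ω', (‖gf y‖₊ : ℝ≥0∞) ^ p) ^ (1/p) := (mul_assoc _ _ _).symm
end
end

section
/- Let φ: Ω → Ω̃ be a weak (n,q)-quasiconformal mapping between domains in ℝⁿ, 1 ≤ q < n. Then there exists a constant C such that for every measurable subset Ã ⊂ Ω̃ the inequality |φ⁻¹(Ã)| ≤ C ∫_Ã (H_q(y))^{nq/(n−q)} dy holds. -/
open MeasureTheory ENNReal Set Filter
open scoped RealInnerProductSpace

noncomputable section

attribute [local instance] Classical.propDecidable

open Metric
open scoped Topology Convolution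

/-- Convolution of a vector field with a normalized smooth bump function. -/
def mollify {n : ℕ} (β : ContDiffBump (0 : Euc n)) (v : Euc n → Euc n) : Euc n → Euc n :=
  β.normed volume ⋆[ContinuousLinearMap.lsmul ℝ ℝ, volume] v

lemma mollify_contDiff {n : ℕ} (β : ContDiffBump (0 : Euc n)) {v : Euc n → Euc n}
    (hv : LocallyIntegrable v) : ContDiff ℝ 1 (mollify β v) :=
  β.hasCompactSupport_normed.contDiff_convolution_left (n := 1) _ β.contDiff_normed hv

lemma enorm_fderiv_mollify_le {n : ℕ} (β : ContDiffBump (0 : Euc n)) {v : Euc n → Euc n}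
    (hv : LocallyIntegrable v) {U : Set (Euc n)} (hU : MeasurableSet U)
    {G : Euc n → Euc n →L[ℝ] Euc n}
    (hw : ∀ η : Euc n → ℝ, ContDiff ℝ (⊤ : ℕ∞) η → HasCompactSupport η → tsupport η ⊆ U →
      ∀ w : Euc n, ∫ x in U, fderiv ℝ η x w • v x = - ∫ x in U, η x • G x w)
    {a : Euc n} (ha : closedBall a β.rOut ⊆ U) :
    ‖fderiv ℝ (mollify β v) a‖ₑ ≤
      ∫⁻ z in U, ENNReal.ofReal (β.normed volume (a - z)) * ‖G z‖ₑ := by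
  set b : Euc n → ℝ := β.normed volume with hb
  have hbs : ContDiff ℝ (⊤ : ℕ∞) b := β.contDiff_normed
  have hcs : HasCompactSupport b := β.hasCompactSupport_normed
  have hd := hcs.hasFDerivAt_convolution_left (ContinuousLinearMap.lsmul ℝ ℝ) (hbs.of_le (by simp))
    hv a
  have hfd : fderiv ℝ (mollify β v) a = _ := hd.fderiv
  refine ContinuousLinearMap.opENorm_le_bound _ fun w => ?_
  set η : Euc n → ℝ := fun z => b (a - z) with hη
  have hηs : ContDiff ℝ (⊤ : ℕ∞) η := hbs.comp (contDiff_const.sub contDiff_id)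
  have hηt : tsupport η ⊆ closedBall a β.rOut := by
    refine closure_minimal (fun z hz => ?_) isClosed_closedBall
    have : a - z ∈ Function.support b := hz
    rw [hb, β.support_normed_eq] at this
    rw [mem_closedBall, dist_comm, dist_eq_norm]
    exact (mem_ball_zero_iff.1 this).le
  have hηc : HasCompactSupport η :=
    HasCompactSupport.of_support_subset_isCompact (isCompact_closedBall a β.rOut)
      ((subset_tsupport η).trans hηt)
  have hηd : ∀ z, fderiv ℝ η z w = - fderiv ℝ b (a - z) w := by
    intro z
    have h1 : HasFDerivAt b (fderiv ℝ b (a - z)) (a - z) :=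
      (hbs.differentiable (by simp) _).hasFDerivAt
    have h2 : HasFDerivAt η ((fderiv ℝ b (a - z)).comp (-ContinuousLinearMap.id ℝ (Euc n))) z :=
      h1.comp z ((hasFDerivAt_id z).const_sub a)
    rw [h2.fderiv]
    simp
  have key : fderiv ℝ (mollify β v) a w = ∫ z in U, η z • G z w := by
    rw [hfd, convolution_eq_swap, ContinuousLinearMap.integral_apply]
    · have e1 := hw η hηs hηc (hηt.trans ha) w
      rw [← neg_eq_iff_eq_neg] at e1
      rw [← e1, ← integral_neg]
      rw [← integral_indicator hU]
      congr 1
      ext1 z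
      by_cases hz : z ∈ U
      · rw [indicator_of_mem hz, hηd]
        simp [ContinuousLinearMap.precompL]
      · rw [indicator_of_notMem hz]
        have : fderiv ℝ η z = 0 := by
          by_contra h
          exact hz (ha (hηt (support_fderiv_subset ℝ h)))
        have h3 := hηd z
        rw [this] at h3
        have h4 : fderiv ℝ b (a - z) w = 0 := by
          simpa using h3.symm
        simp [ContinuousLinearMap.precompL, h4]
    · have hce : ConvolutionExistsAt (fderiv ℝ b) v a
          (((ContinuousLinearMap.lsmul ℝ ℝ : ℝ →L[ℝ] Euc n →L[ℝ] Euc n)).precompL (Euc n)) volume :=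
        (hcs.fderiv ℝ).convolutionExists_left _ (hbs.continuous_fderiv (by simp)) hv a
      exact hce.integrable_swap
  rw [key]
  calc ‖∫ z in U, η z • G z w‖ₑ ≤ ∫⁻ z in U, ‖η z • G z w‖ₑ := enorm_integral_le_lintegral_enorm _
    _ ≤ ∫⁻ z in U, (ENNReal.ofReal (η z) * ‖G z‖ₑ) * ‖w‖ₑ := by
        refine lintegral_mono fun z => ?_
        rw [enorm_smul, mul_assoc, Real.enorm_eq_ofReal (β.nonneg_normed _)]
        gcongr
        exact ContinuousLinearMap.le_opENorm _ _
    _ = _ := by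
        rw [lintegral_mul_const' _ _ enorm_ne_top]

lemma volume_ball_homothety {n : ℕ} (x : Euc n) {t : ℝ} (ht : 0 < t) (R : ℝ) :
    volume (ball x (t * R)) = ENNReal.ofReal (t ^ n) * volume (ball x R) := by
  rw [Measure.addHaar_ball_mul_of_pos (volume : Measure (Euc n)) x ht R,
    Measure.addHaar_ball_center volume x R, finrank_euclideanSpace_fin]

lemma lintegral_ball_homothety {n : ℕ} (k : Euc n → ℝ≥0∞) (x : Euc n) {t : ℝ} (ht : 0 < t)
    (R : ℝ) :
    ENNReal.ofReal (t ^ n) * ∫⁻ y in ball x R, k (x + t • (y - x)) =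
      ∫⁻ y in ball x (t * R), k y := by
  have hd : ∀ y ∈ ball x R, HasFDerivWithinAt (fun y => x + t • (y - x))
      (t • ContinuousLinearMap.id ℝ (Euc n)) (ball x R) y := fun y _ =>
    ((((hasFDerivAt_id y).sub_const x).const_smul t).const_add x).hasFDerivWithinAt
  have hi : InjOn (fun y => x + t • (y - x)) (ball x R) := by
    intro a _ b _ hab
    have := smul_right_injective (Euc n) ht.ne' (add_left_cancel hab)
    simpa using this
  have him : (fun y => x + t • (y - x)) '' ball x R = ball x (t * R) := by
    ext z
    constructor
    · rintro ⟨y, hy, rfl⟩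
      rw [mem_ball, dist_eq_norm] at hy ⊢
      rw [add_sub_cancel_left, norm_smul, Real.norm_of_nonneg ht.le]
      gcongr
    · intro hz
      refine ⟨x + t⁻¹ • (z - x), ?_, ?_⟩
      · rw [mem_ball, dist_eq_norm] at hz ⊢
        rw [add_sub_cancel_left, norm_smul, Real.norm_of_nonneg (inv_nonneg.2 ht.le),
          inv_mul_lt_iff₀ ht]
        exact hz
      · simp [smul_smul, ht.ne']
  have := lintegral_image_eq_lintegral_abs_det_fderiv_mul volume measurableSet_ball hd hi k
  rw [him] at this
  rw [this, ← lintegral_const_mul']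
  · congr 1
    ext1 y
    congr 2
    have : (t • ContinuousLinearMap.id ℝ (Euc n)).det = t ^ n := by
      simp [ContinuousLinearMap.det]
    rw [this, abs_of_pos (pow_pos ht n)]
  · exact ENNReal.ofReal_ne_top

lemma enorm_sub_le_lintegral_fderiv {n : ℕ} {g : Euc n → Euc n} (hg : ContDiff ℝ 1 g)
    (x y : Euc n) :
    ‖g y - g x‖ₑ ≤ ∫⁻ t in Ioc (0 : ℝ) 1, ‖fderiv ℝ g (x + t • (y - x))‖ₑ * ‖y - x‖ₑ := by
  have hc : Continuous fun t : ℝ => fderiv ℝ g (x + t • (y - x)) (y - x) :=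
    ((hg.continuous_fderiv one_ne_zero).comp (by fun_prop)).clm_apply continuous_const
  have h1 : ∀ t ∈ uIcc (0 : ℝ) 1, HasDerivAt (fun t : ℝ => g (x + t • (y - x)))
      (fderiv ℝ g (x + t • (y - x)) (y - x)) t := by
    intro t _
    have h2 : HasDerivAt (fun t : ℝ => x + t • (y - x)) (y - x) t := by
      simpa using ((hasDerivAt_id t).smul_const (y - x)).const_add x
    exact ((hg.differentiable one_ne_zero _).hasFDerivAt).comp_hasDerivAt t h2
  have h3 := intervalIntegral.integral_eq_sub_of_hasDerivAt h1 (hc.intervalIntegrable _ _)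
  rw [intervalIntegral.integral_of_le zero_le_one] at h3
  have h4 : g y - g x = ∫ t in Ioc (0 : ℝ) 1, fderiv ℝ g (x + t • (y - x)) (y - x) := by
    rw [h3]; simp
  rw [h4]
  refine (enorm_integral_le_lintegral_enorm _).trans (lintegral_mono fun t => ?_)
  exact ContinuousLinearMap.le_opENorm _ _

lemma lintegral_enorm_sub_le_of_contDiff {n : ℕ} {g : Euc n → Euc n} (hg : ContDiff ℝ 1 g)
    (x : Euc n) {R : ℝ} {M : ℝ≥0∞}
    (hM : ∀ s, 0 < s → s ≤ R → ∫⁻ y in ball x s, ‖fderiv ℝ g y‖ₑ ≤ M * volume (ball x s)) :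
    ∫⁻ y in ball x R, ‖g y - g x‖ₑ ≤ ENNReal.ofReal R * M * volume (ball x R) := by
  rcases le_or_gt R 0 with hR | hR
  · simp [ball_eq_empty.2 hR]
  have hc : Continuous fun p : Euc n × ℝ => ‖fderiv ℝ g (x + p.2 • (p.1 - x))‖ₑ :=
    ((hg.continuous_fderiv one_ne_zero).comp (by fun_prop)).enorm
  calc ∫⁻ y in ball x R, ‖g y - g x‖ₑ
      ≤ ∫⁻ y in ball x R, ∫⁻ t in Ioc (0 : ℝ) 1,
          ‖fderiv ℝ g (x + t • (y - x))‖ₑ * ENNReal.ofReal R := by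
        refine setLIntegral_mono' measurableSet_ball fun y hy => ?_
        refine (enorm_sub_le_lintegral_fderiv hg x y).trans (lintegral_mono fun t => ?_)
        gcongr
        rw [← ofReal_norm, ← dist_eq_norm]
        exact ENNReal.ofReal_le_ofReal (mem_ball.1 hy).le
    _ = ∫⁻ t in Ioc (0 : ℝ) 1, ∫⁻ y in ball x R,
          ‖fderiv ℝ g (x + t • (y - x))‖ₑ * ENNReal.ofReal R :=
        lintegral_lintegral_swap (hc.measurable.mul_const _).aemeasurable
    _ ≤ ∫⁻ t in Ioc (0 : ℝ) 1, ENNReal.ofReal R * M * volume (ball x R) := by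
        refine setLIntegral_mono' measurableSet_Ioc fun t ht => ?_
        rw [lintegral_mul_const' _ _ ENNReal.ofReal_ne_top, mul_comm, mul_assoc]
        gcongr
        have h1 := lintegral_ball_homothety (fun y => ‖fderiv ℝ g y‖ₑ) x ht.1 R
        have h2 := hM (t * R) (mul_pos ht.1 hR) (by nlinarith [ht.2])
        rw [volume_ball_homothety x ht.1, ← h1, mul_left_comm] at h2
        refine (ENNReal.mul_le_mul_iff_right ?_ ENNReal.ofReal_ne_top).1 h2
        simpa using pow_pos ht.1 n
    _ = _ := by simp

lemma integral_fderiv_smul_eq {n : ℕ} {F : Type*} [NormedAddCommGroup F] [NormedSpace ℝ F]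
    [CompleteSpace F] {f : Euc n → F} (hf : ContDiff ℝ 1 f) {η : Euc n → ℝ} (hη : ContDiff ℝ 1 η)
    (hc : HasCompactSupport η) (v : Euc n) :
    ∫ x, fderiv ℝ η x v • f x = - ∫ x, η x • fderiv ℝ f x v := by
  have hη' : Continuous fun x => fderiv ℝ η x v :=
    (hη.continuous_fderiv one_ne_zero).clm_apply continuous_const
  have hf' : Continuous fun x => fderiv ℝ f x v :=
    (hf.continuous_fderiv one_ne_zero).clm_apply continuous_const
  have hc' : HasCompactSupport fun x => fderiv ℝ η x v := hc.fderiv_apply ℝ v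
  have := integral_smul_fderiv_eq_neg_fderiv_smul_of_integrable (μ := (volume : Measure (Euc n)))
    (f := η) (g := f) (v := v)
    ((hη'.smul hf.continuous).integrable_of_hasCompactSupport hc'.smul_right)
    ((hη.continuous.smul hf').integrable_of_hasCompactSupport hc.smul_right)
    ((hη.continuous.smul hf.continuous).integrable_of_hasCompactSupport hc.smul_right)
    (fun x _ => hη.differentiable one_ne_zero x) (fun x _ => hf.differentiable one_ne_zero x)
  rw [this, neg_neg]

lemma setIntegral_eq_integral_of_tsupport {n : ℕ} {F : Type*} [NormedAddCommGroup F]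
    [NormedSpace ℝ F] {η : Euc n → ℝ} {U : Set (Euc n)} (hU : tsupport η ⊆ U) (f : Euc n → F) :
    ∫ x in U, η x • f x = ∫ x, η x • f x :=
  setIntegral_eq_integral_of_forall_compl_eq_zero fun x hx => by
    rw [image_eq_zero_of_notMem_tsupport fun h => hx (hU h), zero_smul]

lemma setIntegral_fderiv_eq_integral_of_tsupport {n : ℕ} {F : Type*} [NormedAddCommGroup F]
    [NormedSpace ℝ F] {η : Euc n → ℝ} {U : Set (Euc n)} (hU : tsupport η ⊆ U) (v : Euc n)
    (f : Euc n → F) :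
    ∫ x in U, fderiv ℝ η x v • f x = ∫ x, fderiv ℝ η x v • f x :=
  setIntegral_eq_integral_of_tsupport (η := fun x => fderiv ℝ η x v)
    ((tsupport_fderiv_apply_subset ℝ v).trans hU) f

lemma hasWeakDerivOn_of_contDiff {n : ℕ} {f : Euc n → Euc n} (hf : ContDiff ℝ 1 f)
    (U : Set (Euc n)) : HasWeakDerivOn f (fderiv ℝ f) U := by
  refine ⟨hf.continuous.locallyIntegrable.locallyIntegrableOn _,
    (hf.continuous_fderiv one_ne_zero).locallyIntegrable.locallyIntegrableOn _,
    fun η hη hc hU v => ?_⟩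
  rw [setIntegral_fderiv_eq_integral_of_tsupport hU, setIntegral_eq_integral_of_tsupport hU]
  exact integral_fderiv_smul_eq hf (hη.of_le (by simp)) hc v

lemma HasWeakDerivOn.mono {n : ℕ} {f : Euc n → Euc n} {G : Euc n → Euc n →L[ℝ] Euc n}
    {U V : Set (Euc n)} (h : HasWeakDerivOn f G U) (hV : V ⊆ U) : HasWeakDerivOn f G V := by
  refine ⟨h.1.mono_set hV, h.2.1.mono_set hV, fun η hη hc hs v => ?_⟩
  have := h.2.2 η hη hc (hs.trans hV) v
  rwa [setIntegral_fderiv_eq_integral_of_tsupport hs, setIntegral_eq_integral_of_tsupport hs,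
    ← setIntegral_fderiv_eq_integral_of_tsupport (hs.trans hV),
    ← setIntegral_eq_integral_of_tsupport (hs.trans hV)]

lemma integrableOn_smul_of_tsupport {n : ℕ} {F : Type*} [NormedAddCommGroup F] [NormedSpace ℝ F]
    {f : Euc n → F} {U : Set (Euc n)} (hf : LocallyIntegrableOn f U)
    {η : Euc n → ℝ} (hη : Continuous η) (hc : HasCompactSupport η) (hs : tsupport η ⊆ U) :
    IntegrableOn (fun x => η x • f x) U := by
  have h1 : IntegrableOn f (tsupport η) := hf.integrableOn_compact_subset hs hc
  have h2 : IntegrableOn (fun x => η x • f x) (tsupport η) :=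
    h1.continuousOn_smul hη.continuousOn hc
  have h3 : Function.support (fun x => η x • f x) ⊆ tsupport η :=
    (Function.support_smul_subset_left η f).trans (subset_tsupport η)
  exact ((integrableOn_iff_integrable_of_support_subset h3).1 h2).integrableOn

lemma HasWeakDerivOn.sub {n : ℕ} {f f' : Euc n → Euc n} {G G' : Euc n → Euc n →L[ℝ] Euc n}
    {U : Set (Euc n)} (h : HasWeakDerivOn f G U) (h' : HasWeakDerivOn f' G' U) :
    HasWeakDerivOn (fun x => f x - f' x) (fun x => G x - G' x) U := by
  refine ⟨h.1.sub h'.1, h.2.1.sub h'.2.1, fun η hη hc hs v => ?_⟩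
  have hη' : Continuous fun x => fderiv ℝ η x v :=
    (hη.continuous_fderiv (by simp)).clm_apply continuous_const
  have hs' : tsupport (fun x => fderiv ℝ η x v) ⊆ U :=
    (tsupport_fderiv_apply_subset ℝ v).trans hs
  have hc' : HasCompactSupport fun x => fderiv ℝ η x v := hc.fderiv_apply ℝ v
  have ev : ∀ G : Euc n → Euc n →L[ℝ] Euc n, LocallyIntegrableOn G U →
      IntegrableOn (fun x => η x • G x v) U := fun G hG => by
    have := (integrableOn_smul_of_tsupport hG hη.continuous hc hs).apply_continuousLinearMap v
    exact this
  simp only [smul_sub, _root_.sub_apply]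
  rw [integral_sub, integral_sub, h.2.2 η hη hc hs v, h'.2.2 η hη hc hs v]
  · abel
  · exact ev G h.2.1
  · exact ev G' h'.2.1
  · exact integrableOn_smul_of_tsupport h.1 hη' hc' hs'
  · exact integrableOn_smul_of_tsupport h'.1 hη' hc' hs'

lemma lintegral_fderiv_mollify_le {n : ℕ} (β : ContDiffBump (0 : Euc n))
    (hβ : β.rOut = 2 * β.rIn) {v : Euc n → Euc n} (hv : LocallyIntegrable v)
    {G : Euc n → Euc n →L[ℝ] Euc n} {x : Euc n} {s : ℝ} (hs : 0 < s)
    (hG : AEMeasurable (fun y => ‖G y‖ₑ) (volume.restrict (ball x (s + β.rOut))))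
    (hw : ∀ η : Euc n → ℝ, ContDiff ℝ (⊤ : ℕ∞) η → HasCompactSupport η →
      tsupport η ⊆ ball x (s + β.rOut) → ∀ w : Euc n, ∫ x in ball x (s + β.rOut),
        fderiv ℝ η x w • v x = - ∫ x in ball x (s + β.rOut), η x • G x w)
    {M : ℝ≥0∞}
    (hM : ∫⁻ y in ball x (s + β.rOut), ‖G y‖ₑ ≤ M * volume (ball x (s + β.rOut))) :
    ∫⁻ y in ball x s, ‖fderiv ℝ (mollify β v) y‖ₑ ≤ 4 ^ n * M * volume (ball x s) := by
  set ε := β.rOut with hε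
  have hε0 : 0 < ε := β.rOut_pos
  have hpt : ∀ a ∈ ball x s, ‖fderiv ℝ (mollify β v) a‖ₑ ≤
      ∫⁻ z in ball x (s + ε), ENNReal.ofReal (β.normed volume (a - z)) * ‖G z‖ₑ := fun a ha =>
    enorm_fderiv_mollify_le β hv measurableSet_ball hw fun z hz => by
      have := dist_triangle z a x
      rw [mem_ball] at ha ⊢
      rw [mem_closedBall] at hz
      linarith
  have hvol : ∀ t : ℝ, 0 < t → volume (ball x (2 * t)) = 2 ^ n * volume (ball x t) := fun t _ => by
    rw [volume_ball_homothety x two_pos, ENNReal.ofReal_pow two_pos.le]; simp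
  have h42 : (4 : ℝ≥0∞) ^ n = 2 ^ n * 2 ^ n := by rw [← mul_pow]; norm_num
  rcases le_or_gt ε s with hs' | hs'
  · have hone : ∀ z, ∫⁻ a, ENNReal.ofReal (β.normed volume (a - z)) = 1 := fun z => by
      rw [lintegral_sub_right_eq_self (fun a => ENNReal.ofReal (β.normed volume a)) z,
        ← ofReal_integral_eq_lintegral_ofReal β.integrable_normed
          (Eventually.of_forall β.nonneg_normed), β.integral_normed, ENNReal.ofReal_one]
    calc ∫⁻ y in ball x s, ‖fderiv ℝ (mollify β v) y‖ₑ
        ≤ ∫⁻ a in ball x s, ∫⁻ z in ball x (s + ε),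
            ENNReal.ofReal (β.normed volume (a - z)) * ‖G z‖ₑ :=
          setLIntegral_mono' measurableSet_ball hpt
      _ = ∫⁻ z in ball x (s + ε), ∫⁻ a in ball x s,
            ENNReal.ofReal (β.normed volume (a - z)) * ‖G z‖ₑ := by
          refine lintegral_lintegral_swap (AEMeasurable.mul ?_ hG.comp_snd)
          exact (ENNReal.continuous_ofReal.comp
            (β.continuous_normed.comp (continuous_fst.sub continuous_snd))).measurable.aemeasurable
      _ ≤ ∫⁻ z in ball x (s + ε), ‖G z‖ₑ := by
          refine lintegral_mono fun z => ?_
          rw [lintegral_mul_const' _ _ enorm_ne_top]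
          calc _ ≤ 1 * ‖G z‖ₑ := by
                gcongr
                exact (setLIntegral_le_lintegral _ _).trans (hone z).le
            _ = _ := one_mul _
      _ ≤ M * volume (ball x (s + ε)) := hM
      _ ≤ M * volume (ball x (2 * s)) := by gcongr; linarith
      _ ≤ _ := by
          rw [hvol s hs, ← mul_assoc, mul_comm M]
          gcongr ?_ * _ * _
          rw [h42]
          exact le_mul_of_one_le_left' (one_le_pow₀ (by norm_num))
  · have hvε : 0 < volume (ball x ε) := measure_ball_pos _ _ hε0
    have hb : ∀ a, ENNReal.ofReal (β.normed volume a) ≤ 2 ^ n / volume (ball x ε) := fun a => by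
      have := β.normed_le_div_measure_closedBall_rOut volume 2 hβ.le a
      refine (ENNReal.ofReal_le_ofReal this).trans ?_
      have : Measure.real volume (closedBall (0 : Euc n) ε) = (volume (ball (0 : Euc n) ε)).toReal := by
        rw [Measure.real, Measure.addHaar_closedBall volume _ hε0.le, Measure.addHaar_ball_of_pos volume _ hε0]
      rw [this, ENNReal.ofReal_div_of_pos (ENNReal.toReal_pos (measure_ball_pos _ _ hε0).ne'
          measure_ball_lt_top.ne), ENNReal.ofReal_toReal measure_ball_lt_top.ne,
        Measure.addHaar_ball_center volume x, finrank_euclideanSpace_fin,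
        ENNReal.ofReal_pow two_pos.le]
      simp
    have hpt' : ∀ a ∈ ball x s, ‖fderiv ℝ (mollify β v) a‖ₑ ≤ 4 ^ n * M := fun a ha => by
      calc _ ≤ _ := hpt a ha
        _ ≤ ∫⁻ z in ball x (s + ε), 2 ^ n / volume (ball x ε) * ‖G z‖ₑ := by
          refine lintegral_mono fun z => ?_
          gcongr
          exact hb _
        _ = 2 ^ n / volume (ball x ε) * ∫⁻ z in ball x (s + ε), ‖G z‖ₑ := by
          rw [lintegral_const_mul' _ _ (ENNReal.div_ne_top (by simp) hvε.ne')]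
        _ ≤ 2 ^ n / volume (ball x ε) * (M * volume (ball x (2 * ε))) := by
          gcongr
          refine hM.trans ?_
          gcongr
          linarith
        _ = 4 ^ n * M * (volume (ball x ε) / volume (ball x ε)) := by
          rw [hvol ε hε0, h42, div_eq_mul_inv, div_eq_mul_inv]
          ring
        _ = _ := by rw [ENNReal.div_self hvε.ne' measure_ball_lt_top.ne, mul_one]
    calc _ ≤ ∫⁻ _ in ball x s, 4 ^ n * M := setLIntegral_mono' measurableSet_ball hpt'
      _ = _ := by simp

/-- A sequence of smooth bump functions shrinking to the origin. -/
def bumpSeq (n : ℕ) (T : ℝ) (hT : 0 < T) (k : ℕ) : ContDiffBump (0 : Euc n) where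
  rIn := T / (2 * (k + 1))
  rOut := T / (k + 1)
  rIn_pos := by positivity
  rIn_lt_rOut := by
    apply div_lt_div_of_pos_left hT (by positivity)
    have : (0 : ℝ) < k + 1 := by positivity
    linarith

lemma bumpSeq_rOut_le {n : ℕ} {T : ℝ} (hT : 0 < T) (k : ℕ) : (bumpSeq n T hT k).rOut ≤ T :=
  div_le_self hT.le (by simp)

lemma bumpSeq_rOut_eq {n : ℕ} {T : ℝ} (hT : 0 < T) (k : ℕ) :
    (bumpSeq n T hT k).rOut = 2 * (bumpSeq n T hT k).rIn := by
  simp only [bumpSeq]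
  field_simp

lemma tendsto_bumpSeq_rOut {n : ℕ} {T : ℝ} (hT : 0 < T) :
    Tendsto (fun k => (bumpSeq n T hT k).rOut) atTop (𝓝 0) :=
  tendsto_const_div_atTop_nhds_zero_nat T |>.comp (tendsto_add_atTop_nat 1) |>.congr fun k => by
    simp [bumpSeq]

lemma tendsto_mollify {n : ℕ} {T : ℝ} (hT : 0 < T) {v : Euc n → Euc n}
    (hv : AEStronglyMeasurable v volume) {x : Euc n} (hx : ContinuousAt v x) :
    Tendsto (fun k => mollify (bumpSeq n T hT k) v x) atTop (𝓝 (v x)) :=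
  ContDiffBump.convolution_tendsto_right (tendsto_bumpSeq_rOut hT)
    (Eventually.of_forall fun _ => hv) (hx.tendsto.comp tendsto_snd) tendsto_const_nhds

lemma lintegral_enorm_sub_le_of_hasWeakDerivOn {n : ℕ} {v : Euc n → Euc n}
    {G : Euc n → Euc n →L[ℝ] Euc n} {x : Euc n} {T : ℝ} (hT : 0 < T)
    (h : HasWeakDerivOn v G (ball x T)) (hv : ContinuousOn v (ball x T)) {M : ℝ≥0∞}
    (hM : ∀ t, 0 < t → t < T → ∫⁻ y in ball x t, ‖G y‖ₑ ≤ M * volume (ball x t))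
    {R : ℝ} (hR : R ≤ T / 4) :
    ∫⁻ y in ball x R, ‖v y - v x‖ₑ ≤ ENNReal.ofReal R * (4 ^ n * M) * volume (ball x R) := by
  have hT8 : 0 < T / 8 := by positivity
  have hcl : closedBall x (T / 2) ⊆ ball x T := closedBall_subset_ball (by linarith)
  set V := indicator (closedBall x (T / 2)) v with hV
  have hVi : Integrable V := by
    rw [hV, integrable_indicator_iff measurableSet_closedBall]
    exact (hv.mono hcl).integrableOn_compact (isCompact_closedBall _ _)
  have hVeq : ∀ y ∈ ball x (T / 2), V y = v y := fun y hy =>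
    indicator_of_mem (ball_subset_closedBall hy) _
  have hVc : ∀ y ∈ ball x (T / 2), ContinuousAt V y := fun y hy => by
    have h1 : ContinuousAt v y :=
      (hv y (hcl (ball_subset_closedBall hy))).continuousAt
        (isOpen_ball.mem_nhds (hcl (ball_subset_closedBall hy)))
    refine h1.congr ?_
    filter_upwards [isOpen_ball.mem_nhds hy] with z hz using (hVeq z hz).symm
  have hGm : AEMeasurable (fun y => ‖G y‖ₑ) (volume.restrict (ball x T)) :=
    (h.2.1.aestronglyMeasurable).enorm
  have hbound : ∀ k, ∫⁻ y in ball x R,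
      ‖mollify (bumpSeq n _ hT8 k) V y - mollify (bumpSeq n _ hT8 k) V x‖ₑ ≤
      ENNReal.ofReal R * (4 ^ n * M) * volume (ball x R) := fun k => by
    refine lintegral_enorm_sub_le_of_contDiff (mollify_contDiff _ hVi.locallyIntegrable) x
      fun s hs hsR => ?_
    have hlt : s + (bumpSeq n _ hT8 k).rOut < T / 2 := by
      have := bumpSeq_rOut_le (n := n) hT8 k
      linarith
    have hpos : 0 < s + (bumpSeq n _ hT8 k).rOut := add_pos hs (ContDiffBump.rOut_pos _)
    refine lintegral_fderiv_mollify_le _ (bumpSeq_rOut_eq hT8 k) hVi.locallyIntegrable hs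
      (hGm.mono_measure (Measure.restrict_mono (ball_subset_ball (by linarith)) le_rfl)) ?_
      (hM _ hpos (by linarith))
    intro η hη hc hs' w
    have h2 := (h.mono (V := ball x (s + (bumpSeq n _ hT8 k).rOut))
      (ball_subset_ball (by linarith))).2.2 η hη hc hs' w
    rw [← h2]
    refine setIntegral_congr_fun measurableSet_ball fun y hy => ?_
    rw [hVeq y (ball_subset_ball hlt.le hy)]
  have hpt : ∀ y ∈ ball x R, ‖v y - v x‖ₑ = liminf (fun k =>
      ‖mollify (bumpSeq n _ hT8 k) V y - mollify (bumpSeq n _ hT8 k) V x‖ₑ) atTop := fun y hy => by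
    have hy' : y ∈ ball x (T / 2) := ball_subset_ball (by linarith) hy
    have hx' : x ∈ ball x (T / 2) := mem_ball_self (by positivity)
    have h1 := tendsto_mollify hT8 hVi.aestronglyMeasurable (hVc y hy')
    have h2 := tendsto_mollify hT8 hVi.aestronglyMeasurable (hVc x hx')
    rw [← hVeq y hy', ← hVeq x hx']
    exact (h1.sub h2).enorm.liminf_eq.symm
  calc _ = ∫⁻ y in ball x R, liminf (fun k =>
      ‖mollify (bumpSeq n _ hT8 k) V y - mollify (bumpSeq n _ hT8 k) V x‖ₑ) atTop :=
        setLIntegral_congr_fun measurableSet_ball hpt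
    _ ≤ liminf (fun k => ∫⁻ y in ball x R,
      ‖mollify (bumpSeq n _ hT8 k) V y - mollify (bumpSeq n _ hT8 k) V x‖ₑ) atTop := by
        refine lintegral_liminf_le fun k => ?_
        exact ((mollify_contDiff _ hVi.locallyIntegrable).continuous.sub
          continuous_const).enorm.measurable
    _ ≤ _ := by
        refine liminf_le_of_le (by isBoundedDefault) fun b hb => ?_
        obtain ⟨k, hk⟩ := hb.exists
        exact hk.trans (hbound k)

/-- The averages of `‖G - T‖` over all balls centered at `x` of radius less than `r` are
at most `δ`. -/
def MeanOscLE {n : ℕ} (G : Euc n → Euc n →L[ℝ] Euc n) (T : Euc n →L[ℝ] Euc n) (δ : ℝ≥0∞) (r : ℝ)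
    (x : Euc n) : Prop :=
  ∀ t, 0 < t → t < r → ∫⁻ y in ball x t, ‖G y - T‖ₑ ≤ δ * volume (ball x t)

lemma volume_ball_two_mul {n : ℕ} (x z : Euc n) (t : ℝ) :
    volume (ball z (2 * t)) = 2 ^ n * volume (ball x t) := by
  rw [volume_ball_homothety z two_pos, ENNReal.ofReal_pow two_pos.le,
    Measure.addHaar_ball_center volume z, Measure.addHaar_ball_center volume x]
  simp

lemma ball_subset_ball_two_mul_dist {n : ℕ} (x z : Euc n) :
    ball x (dist x z) ⊆ ball z (2 * dist x z) := fun y hy => by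
  have := dist_triangle y x z
  rw [mem_ball] at hy ⊢
  linarith

lemma MeanOscLE.enorm_center_sub_le {n : ℕ} {G : Euc n → Euc n →L[ℝ] Euc n} {T T' : Euc n →L[ℝ] Euc n}
    {δ : ℝ≥0∞} {r : ℝ} {x z : Euc n} {U : Set (Euc n)}
    (hG : AEMeasurable (fun y => ‖G y - T‖ₑ) (volume.restrict U)) (hU : ball x r ⊆ U)
    (hx : MeanOscLE G T δ r x) (hz : MeanOscLE G T' δ r z) (hxz : x ≠ z)
    (hr : 2 * dist x z < r) : ‖T - T'‖ₑ ≤ δ * (1 + 2 ^ n) := by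
  have hd : 0 < dist x z := dist_pos.2 hxz
  have hv : volume (ball x (dist x z)) ≠ 0 := (measure_ball_pos _ _ hd).ne'
  refine (ENNReal.mul_le_mul_iff_left hv measure_ball_lt_top.ne).1 ?_
  calc ‖T - T'‖ₑ * volume (ball x (dist x z)) = ∫⁻ y in ball x (dist x z), ‖T - T'‖ₑ := by simp
    _ ≤ ∫⁻ y in ball x (dist x z), (‖G y - T‖ₑ + ‖G y - T'‖ₑ) := by
        refine lintegral_mono fun y => ?_
        have : T - T' = (G y - T') - (G y - T) := by abel
        rw [this, add_comm]
        exact enorm_sub_le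
    _ = (∫⁻ y in ball x (dist x z), ‖G y - T‖ₑ) + ∫⁻ y in ball x (dist x z), ‖G y - T'‖ₑ :=
        lintegral_add_left' (hG.mono_measure (Measure.restrict_mono
          ((ball_subset_ball (by linarith)).trans hU) le_rfl)) _
    _ ≤ δ * volume (ball x (dist x z)) + δ * volume (ball z (2 * dist x z)) := by
        gcongr
        · exact hx _ hd (by linarith)
        · exact (lintegral_mono_set (ball_subset_ball_two_mul_dist x z)).trans
            (hz _ (by positivity) hr)
    _ = _ := by rw [volume_ball_two_mul x z]; ring

/-- Dimensional constant in the two-point estimate. -/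
def twoPointConst (n : ℕ) : ℝ≥0∞ := 4 ^ n * (1 + 2 * 2 ^ n)

lemma enorm_sub_sub_le_of_meanOscLE {n : ℕ} {v : Euc n → Euc n} {G : Euc n → Euc n →L[ℝ] Euc n}
    {U : Set (Euc n)} (h : HasWeakDerivOn v G U) (hv : ContinuousOn v U) {T : Euc n →L[ℝ] Euc n}
    {δ : ℝ≥0∞} {r : ℝ} {x z : Euc n} (hxU : ball x r ⊆ U) (hzU : ball z r ⊆ U)
    (hx : MeanOscLE G T δ r x) (hz : MeanOscLE G T δ r z) (hr : 8 * dist x z < r) :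
    ‖v z - v x - T (z - x)‖ₑ ≤ twoPointConst n * δ * ENNReal.ofReal (dist x z) := by
  rcases eq_or_ne x z with rfl | hxz
  · simp
  have hd : 0 < dist x z := dist_pos.2 hxz
  have hr0 : 0 < r := by linarith
  have hw : HasWeakDerivOn (fun y => v y - T y) (fun y => G y - T) U := by
    have := h.sub ((hasWeakDerivOn_of_contDiff T.contDiff U))
    simpa only [ContinuousLinearMap.fderiv] using this
  have hwc : ContinuousOn (fun y => v y - T y) U := hv.sub T.continuous.continuousOn
  have h1 := lintegral_enorm_sub_le_of_hasWeakDerivOn hr0 (hw.mono hxU) (hwc.mono hxU) hx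
    (R := dist x z) (by linarith)
  have h2 := lintegral_enorm_sub_le_of_hasWeakDerivOn hr0 (hw.mono hzU) (hwc.mono hzU) hz
    (R := 2 * dist x z) (by linarith)
  have hvol : volume (ball x (dist x z)) ≠ 0 := (measure_ball_pos _ _ hd).ne'
  refine (ENNReal.mul_le_mul_iff_left hvol measure_ball_lt_top.ne).1 ?_
  set w := fun y => v y - T y
  have hwm : AEMeasurable (fun y => ‖w y - w x‖ₑ) (volume.restrict (ball x (dist x z))) :=
    (((hwc.mono ((ball_subset_ball (by linarith)).trans hxU)).sub continuousOn_const).enorm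
      ).aemeasurable measurableSet_ball
  calc ‖v z - v x - T (z - x)‖ₑ * volume (ball x (dist x z))
      = ∫⁻ y in ball x (dist x z), ‖w z - w x‖ₑ := by
        have : v z - v x - T (z - x) = w z - w x := by simp only [w, map_sub]; abel
        rw [this]; simp
    _ ≤ ∫⁻ y in ball x (dist x z), (‖w y - w x‖ₑ + ‖w y - w z‖ₑ) := by
        refine lintegral_mono fun y => ?_
        have : w z - w x = (w y - w x) - (w y - w z) := by abel
        rw [this]
        exact enorm_sub_le
    _ = (∫⁻ y in ball x (dist x z), ‖w y - w x‖ₑ) + ∫⁻ y in ball x (dist x z), ‖w y - w z‖ₑ :=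
        lintegral_add_left' hwm _
    _ ≤ _ := add_le_add h1
        ((lintegral_mono_set (ball_subset_ball_two_mul_dist x z)).trans h2)
    _ = _ := by
        rw [volume_ball_two_mul x z, twoPointConst, ENNReal.ofReal_mul two_pos.le]
        simp only [ENNReal.ofReal_ofNat]
        ring

lemma MeanOscLE.change {n : ℕ} {G : Euc n → Euc n →L[ℝ] Euc n} {T T' : Euc n →L[ℝ] Euc n}
    {δ δ' : ℝ≥0∞} {r : ℝ} {z : Euc n} (hz : MeanOscLE G T' δ r z) (h : ‖T - T'‖ₑ ≤ δ') :
    MeanOscLE G T (δ + δ') r z := fun t ht htr => by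
  calc ∫⁻ y in ball z t, ‖G y - T‖ₑ ≤ ∫⁻ y in ball z t, (‖G y - T'‖ₑ + δ') := by
        refine lintegral_mono fun y => ?_
        have : G y - T = (G y - T') - (T - T') := by abel
        rw [this]
        exact enorm_sub_le.trans (by gcongr)
    _ = (∫⁻ y in ball z t, ‖G y - T'‖ₑ) + δ' * volume (ball z t) := by
        rw [lintegral_add_right _ measurable_const]; simp
    _ ≤ _ := by
        rw [add_mul]
        gcongr
        exact hz t ht htr

lemma hasFDerivWithinAt_of_uniform_meanOscLE {n : ℕ} {v : Euc n → Euc n}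
    {G : Euc n → Euc n →L[ℝ] Euc n} {U E : Set (Euc n)} (hU : IsOpen U)
    (h : HasWeakDerivOn v G U) (hv : ContinuousOn v U) (hE : E ⊆ U)
    (hunif : ∀ δ : ℝ≥0∞, 0 < δ → ∃ r > 0, ∀ x ∈ E, MeanOscLE G (G x) δ r x) {x : Euc n}
    (hx : x ∈ E) : HasFDerivWithinAt v (G x) E x := by
  rw [hasFDerivWithinAt_iff_isLittleO, Asymptotics.isLittleO_iff]
  intro c hc
  set K : ℝ≥0∞ := twoPointConst n * (1 + (1 + 2 ^ n)) with hK
  have hK0 : K ≠ 0 := by simp [hK, twoPointConst]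
  have hKt : K ≠ ∞ := by
    simp only [hK, twoPointConst]
    finiteness
  set δ : ℝ≥0∞ := ENNReal.ofReal c / K with hδ
  have hδ0 : 0 < δ := ENNReal.div_pos (by simpa using hc) hKt
  obtain ⟨r₁, hr₁, hr₁'⟩ := hunif δ hδ0
  obtain ⟨r₂, hr₂, hr₂'⟩ := Metric.isOpen_iff.1 hU x (hE hx)
  set r := min r₁ (r₂ / 2) with hr
  have hr0 : 0 < r := by positivity
  have hosc : ∀ y ∈ E, MeanOscLE G (G y) δ r y := fun y hy t ht htr =>
    hr₁' y hy t ht (htr.trans_le (min_le_left _ _))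
  filter_upwards [self_mem_nhdsWithin, mem_nhdsWithin_of_mem_nhds (ball_mem_nhds x
    (show 0 < r / 8 by positivity))] with z hz hzx
  rw [mem_ball, dist_comm] at hzx
  have hxU : ball x r ⊆ U := (ball_subset_ball ((min_le_right _ _).trans (by linarith))).trans hr₂'
  have hzU : ball z r ⊆ U := fun y hy => hr₂' <| by
    have h1 := dist_triangle y z x
    have h2 : r ≤ r₂ / 2 := min_le_right _ _
    rw [mem_ball] at hy ⊢
    rw [dist_comm z x] at h1
    linarith
  rcases eq_or_ne x z with rfl | hxz
  · simp
  have hT : ‖G x - G z‖ₑ ≤ δ * (1 + 2 ^ n) :=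
    (hosc x hx).enorm_center_sub_le (((h.2.1.aestronglyMeasurable).sub
      aestronglyMeasurable_const).enorm) hxU (hosc z hz) hxz (by linarith)
  have hz' : MeanOscLE G (G x) (δ + δ * (1 + 2 ^ n)) r z := (hosc z hz).change hT
  have hx' : MeanOscLE G (G x) (δ + δ * (1 + 2 ^ n)) r x := fun t ht htr =>
    (hosc x hx t ht htr).trans (by gcongr; exact le_self_add)
  have := enorm_sub_sub_le_of_meanOscLE h hv hxU hzU hx' hz' (by linarith)
  have e : twoPointConst n * (δ + δ * (1 + 2 ^ n)) = ENNReal.ofReal c := by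
    have : twoPointConst n * (δ + δ * (1 + 2 ^ n)) = K * δ := by rw [hK]; ring
    rw [this, hδ, ENNReal.mul_div_cancel hK0 hKt]
  rw [e, ← ENNReal.ofReal_mul hc.le, ← ofReal_norm, dist_comm, dist_eq_norm,
    ENNReal.ofReal_le_ofReal_iff (by positivity)] at this
  exact this

lemma integrable_indicator_of_integrableOn {α F : Type*} [MeasurableSpace α] {μ : Measure α}
    [NormedAddCommGroup F] {f : α → F} {U : Set α} (hf : IntegrableOn f U μ)
    (hU : MeasurableSet U) : Integrable (indicator U f) μ :=
  hf.integrable_indicator hU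

lemma measurable_setLIntegral_ball {n : ℕ} {G : Euc n → Euc n →L[ℝ] Euc n}
    (hG : StronglyMeasurable G) (r : ℝ) :
    Measurable fun x => ∫⁻ y in ball x r, ‖G y - G x‖ₑ := by
  have h1 : MeasurableSet {p : Euc n × Euc n | dist p.2 p.1 < r} :=
    (isOpen_lt (continuous_snd.dist continuous_fst) continuous_const).measurableSet
  have h2 : Measurable fun p : Euc n × Euc n => ‖G p.2 - G p.1‖ₑ :=
    ((hG.comp_measurable measurable_snd).sub (hG.comp_measurable measurable_fst)).enorm
  have h3 := (h2.indicator h1).lintegral_prod_right' (ν := (volume : Measure (Euc n)))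
  convert h3 using 2 with x
  rw [← lintegral_indicator measurableSet_ball]
  rfl

lemma exists_uniform_meanOscLE {n : ℕ} {G : Euc n → Euc n →L[ℝ] Euc n}
    (hG : StronglyMeasurable G) (hGi : Integrable G) {U : Set (Euc n)} (hU : MeasurableSet U)
    (hUf : volume U ≠ ∞) {ε : ℝ} (hε : 0 < ε) :
    ∃ E ⊆ U, MeasurableSet E ∧ volume (U \ E) ≤ ENNReal.ofReal ε ∧
      ∀ δ : ℝ≥0∞, 0 < δ → ∃ r > 0, ∀ x ∈ E, MeanOscLE G (G x) δ r x := by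
  set a : ℕ → Euc n → ℝ≥0∞ := fun j x =>
    (∫⁻ y in ball x ((1 / 2) ^ j), ‖G y - G x‖ₑ) / volume (ball x ((1 / 2) ^ j)) with ha
  have hpos : ∀ j : ℕ, (0 : ℝ) < (1 / 2) ^ j := fun j => by positivity
  have hv0 : ∀ j x, volume (ball x ((1 / 2 : ℝ) ^ j) : Set (Euc n)) ≠ 0 := fun j x =>
    (measure_ball_pos _ _ (hpos j)).ne'
  have hfin : ∀ j x, a j x ≠ ∞ := fun j x => by
    refine ENNReal.div_ne_top ?_ (hv0 j x)
    have : IntegrableOn (fun y => G y - G x) (ball x ((1 / 2) ^ j)) :=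
      hGi.integrableOn.sub (integrableOn_const measure_ball_lt_top.ne)
    exact this.2.ne
  have hmeas : ∀ j, Measurable (a j) := fun j => by
    refine (measurable_setLIntegral_ball hG _).div ?_
    have : (fun x : Euc n => volume (ball x ((1 / 2 : ℝ) ^ j))) = fun _ =>
        volume (ball (0 : Euc n) ((1 / 2 : ℝ) ^ j)) :=
      funext fun x => Measure.addHaar_ball_center volume x _
    rw [this]
    exact measurable_const
  have hae : ∀ᵐ x, x ∈ U → Tendsto (fun j => (a j x).toReal) atTop (𝓝 0) := by
    filter_upwards [(Besicovitch.vitaliFamily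
      (volume : Measure (Euc n))).ae_tendsto_lintegral_enorm_sub_div hGi.locallyIntegrable]
      with x hx _
    have h1 : Tendsto (fun j : ℕ => ((1 : ℝ) / 2) ^ j) atTop (𝓝[>] 0) :=
      tendsto_nhdsWithin_iff.2 ⟨tendsto_pow_atTop_nhds_zero_of_lt_one (by norm_num) (by norm_num),
        Eventually.of_forall hpos⟩
    have h2 := (hx.comp (Besicovitch.tendsto_filterAt volume x)).comp h1
    have h3 : Tendsto (fun j => a j x) atTop (𝓝 0) := by
      refine tendsto_of_tendsto_of_tendsto_of_le_of_le tendsto_const_nhds h2 (fun _ => zero_le)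
        fun j => ?_
      have : volume (closedBall x ((1 / 2 : ℝ) ^ j)) = volume (ball x ((1 / 2 : ℝ) ^ j)) := by
        rw [Measure.addHaar_closedBall volume _ (hpos j).le,
          Measure.addHaar_ball_of_pos volume _ (hpos j)]
      simp only [ha, Function.comp, this]
      exact ENNReal.div_le_div_right (lintegral_mono_set ball_subset_closedBall) _
    exact (ENNReal.tendsto_toReal ENNReal.zero_ne_top).comp h3
  obtain ⟨t, htU, htm, ht, hunif⟩ := tendstoUniformlyOn_of_ae_tendsto
    (fun j => (hmeas j).ennreal_toReal.stronglyMeasurable) (stronglyMeasurable_const (b := (0 : ℝ))) hU hUf hae hε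
  refine ⟨U \ t, sdiff_subset, hU.diff htm, ?_, fun δ hδ => ?_⟩
  · exact (measure_mono fun x hx => by_contra fun h => hx.2 ⟨hx.1, h⟩).trans ht
  rw [Metric.tendstoUniformlyOn_iff] at hunif
  have hm0 : min δ 1 / 2 ^ n ≠ 0 :=
    (ENNReal.div_pos (lt_min hδ one_pos).ne' (by finiteness)).ne'
  have hmt : min δ 1 / 2 ^ n ≠ ∞ :=
    ENNReal.div_ne_top (ne_top_of_le_ne_top one_ne_top (min_le_right _ _)) (by simp)
  obtain ⟨J, hJ⟩ := (hunif _ (ENNReal.toReal_pos hm0 hmt)).exists_forall_of_atTop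
  refine ⟨(1 / 2) ^ J, hpos J, fun x hx s hs hsJ => ?_⟩
  obtain ⟨j, hj1, hj2⟩ := exists_nat_pow_near_of_lt_one hs
    (hsJ.le.trans (pow_le_one₀ (by norm_num) (by norm_num))) (show (0 : ℝ) < 1 / 2 by norm_num)
    (by norm_num)
  have hjJ : J ≤ j := by
    by_contra! hlt
    have : ((1 : ℝ) / 2) ^ J ≤ (1 / 2) ^ (j + 1) :=
      pow_le_pow_of_le_one (by norm_num) (by norm_num) hlt
    linarith
  have h1 := hJ j hjJ x hx
  rw [dist_zero_left, Real.norm_of_nonneg ENNReal.toReal_nonneg,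
    ENNReal.toReal_lt_toReal (hfin j x) hmt, ENNReal.div_lt_iff (Or.inl (hv0 j x))
      (Or.inl measure_ball_lt_top.ne)] at h1
  calc ∫⁻ y in ball x s, ‖G y - G x‖ₑ
      ≤ ∫⁻ y in ball x ((1 / 2) ^ j), ‖G y - G x‖ₑ := lintegral_mono_set (ball_subset_ball hj2)
    _ ≤ min δ 1 / 2 ^ n * volume (ball x ((1 / 2) ^ j)) := h1.le
    _ = min δ 1 / 2 ^ n * (2 ^ n * volume (ball x ((1 / 2) ^ (j + 1)))) := by
        rw [← volume_ball_two_mul x x]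
        congr 3
        ring
    _ ≤ δ * volume (ball x s) := by
        rw [← mul_assoc, ENNReal.div_mul_cancel (by simp) (by finiteness)]
        gcongr
        exact min_le_left _ _

lemma exists_hasFDerivWithinAt_ball {n : ℕ} {v : Euc n → Euc n}
    {G : Euc n → Euc n →L[ℝ] Euc n} {x₀ : Euc n} {R : ℝ}
    (h : HasWeakDerivOn v G (ball x₀ R)) (hv : ContinuousOn v (ball x₀ R))
    (hG : IntegrableOn G (ball x₀ R)) {ε : ℝ} (hε : 0 < ε) :
    ∃ E ⊆ ball x₀ R, MeasurableSet E ∧ volume (ball x₀ R \ E) ≤ ENNReal.ofReal ε ∧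
      ∀ x ∈ E, HasFDerivWithinAt v (G x) E x := by
  obtain ⟨U, hUdef⟩ : ∃ U, U = ball x₀ R := ⟨_, rfl⟩
  have hUo : IsOpen U := hUdef ▸ isOpen_ball
  have hUf : volume U ≠ ∞ := hUdef ▸ measure_ball_lt_top.ne
  rw [← hUdef] at h hv hG ⊢
  have hU : MeasurableSet U := hUo.measurableSet
  have hi : Integrable (indicator U G) := integrable_indicator_of_integrableOn hG hU
  obtain ⟨G', hGs, hG'⟩ := hi.aestronglyMeasurable
  have hGG : G =ᵐ[volume.restrict U] G' := by
    filter_upwards [ae_restrict_of_ae hG', ae_restrict_mem hU] with y hy hyU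
    rwa [indicator_of_mem hyU] at hy
  obtain ⟨E, hEU, hEm, hEv, hEunif⟩ := exists_uniform_meanOscLE hGs
    (hi.congr hG') hU hUf hε
  obtain ⟨N, hN', hNm, hN⟩ := exists_measurable_superset_of_null (ae_iff.1 hG')
  refine ⟨E \ N, sdiff_subset.trans hEU, hEm.diff hNm, ?_, ?_⟩
  · calc volume (U \ (E \ N)) ≤ volume ((U \ E) ∪ N) := measure_mono fun y hy => by
          by_cases hyE : y ∈ E
          · exact Or.inr (by_contra fun h => hy.2 ⟨hyE, h⟩)
          · exact Or.inl ⟨hy.1, hyE⟩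
      _ ≤ volume (U \ E) + volume N := measure_union_le _ _
      _ ≤ _ := by rw [hN, add_zero]; exact hEv
  · have heq : ∀ y ∈ E \ N, G y = G' y := fun y hy => by
      have h1 : indicator U G y = G' y := by_contra fun h => hy.2 (hN' h)
      rwa [indicator_of_mem (hEU hy.1)] at h1
    have h' : HasWeakDerivOn v G' U := by
      refine ⟨h.1, (hi.congr hG').locallyIntegrable.locallyIntegrableOn _, fun η hη hc hs w => ?_⟩
      rw [h.2.2 η hη hc hs w]
      congr 1
      exact integral_congr_ae (by filter_upwards [hGG] with y hy; rw [hy])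
    intro x hx
    rw [heq x hx]
    exact (hasFDerivWithinAt_of_uniform_meanOscLE hUo h' hv hEU hEunif hx.1).mono
      sdiff_subset

lemma exists_countable_cover_hasFDerivWithinAt {n : ℕ} {v : Euc n → Euc n}
    {G : Euc n → Euc n →L[ℝ] Euc n} {Ω : Set (Euc n)} (hΩ : IsOpen Ω)
    (h : HasWeakDerivOn v G Ω) (hv : ContinuousOn v Ω) :
    ∃ E : ℕ → Set (Euc n), (∀ k, MeasurableSet (E k)) ∧ (∀ k, E k ⊆ Ω) ∧
      volume (Ω \ ⋃ k, E k) = 0 ∧ ∀ k, ∀ x ∈ E k, HasFDerivWithinAt v (G x) (E k) x := by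
  have hr : ∀ x ∈ Ω, ∃ r > 0, closedBall x r ⊆ Ω := fun x hx =>
    Metric.nhds_basis_closedBall.mem_iff.1 (hΩ.mem_nhds hx)
  choose! r hr0 hrΩ using hr
  obtain ⟨t, htΩ, htc, hcov⟩ := TopologicalSpace.countable_cover_nhdsWithin
    (f := fun x => ball x (r x)) (s := Ω)
    fun x hx => mem_nhdsWithin_of_mem_nhds (ball_mem_nhds x (hr0 x hx))
  have hloc : ∀ x ∈ t, ∀ k : ℕ, ∃ E ⊆ ball x (r x), MeasurableSet E ∧
      volume (ball x (r x) \ E) ≤ ENNReal.ofReal (1 / (k + 1)) ∧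
      ∀ y ∈ E, HasFDerivWithinAt v (G y) E y := fun x hx k => by
    have hb : ball x (r x) ⊆ Ω := ball_subset_closedBall.trans (hrΩ x (htΩ hx))
    exact exists_hasFDerivWithinAt_ball (h.mono hb) (hv.mono hb)
      ((h.2.1.integrableOn_compact_subset (hrΩ x (htΩ hx)) (isCompact_closedBall _ _)).mono_set
        ball_subset_closedBall) (by positivity)
  choose! E hEb hEm hEv hEd using hloc
  have := htc.to_subtype
  have hnull : volume (Ω \ ⋃ p : t × ℕ, E p.1 p.2) = 0 := by
    have hsub : Ω \ ⋃ p : t × ℕ, E p.1 p.2 ⊆ ⋃ x : t, ball x.1 (r x) \ ⋃ k, E x k := fun y hy => by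
      obtain ⟨x, hx, hyx⟩ := mem_iUnion₂.1 (hcov hy.1)
      refine mem_iUnion.2 ⟨⟨x, hx⟩, hyx, fun h => hy.2 ?_⟩
      obtain ⟨k, hk⟩ := mem_iUnion.1 h
      exact mem_iUnion.2 ⟨(⟨x, hx⟩, k), hk⟩
    refine measure_mono_null hsub (measure_iUnion_null fun x => ?_)
    refine le_antisymm (ge_of_tendsto' (x := atTop)
      (f := fun k : ℕ => ENNReal.ofReal (1 / ((k : ℝ) + 1))) ?_ fun k => ?_) zero_le
    · simpa using ENNReal.tendsto_ofReal tendsto_one_div_add_atTop_nhds_zero_nat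
    · exact (measure_mono (sdiff_subset_sdiff_right (subset_iUnion (fun k => E x.1 k) k))).trans
        (hEv x x.2 k)
  rcases isEmpty_or_nonempty (t × ℕ) with he | he
  · refine ⟨fun _ => ∅, fun _ => .empty, fun _ => empty_subset _, ?_, fun _ _ hx => hx.elim⟩
    simpa using hnull
  obtain ⟨e, he⟩ := exists_surjective_nat (t × ℕ)
  refine ⟨fun k => E (e k).1 (e k).2, fun k => hEm _ (e k).1.2 _, fun k => ?_, ?_, fun k =>
    hEd _ (e k).1.2 _⟩
  · exact (hEb _ (e k).1.2 _).trans (ball_subset_closedBall.trans (hrΩ _ (htΩ (e k).1.2)))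
  · rwa [he.iUnion_comp (fun p : t × ℕ => E p.1 p.2)]

lemma ae_eq_of_hasFDerivWithinAt {n : ℕ} {f : Euc n → Euc n} {A : Set (Euc n)}
    (hA : MeasurableSet A) {T T' : Euc n → Euc n →L[ℝ] Euc n}
    (h : ∀ x ∈ A, HasFDerivWithinAt f (T x) A x) (h' : ∀ x ∈ A, HasFDerivWithinAt f (T' x) A x) :
    ∀ᵐ x ∂volume.restrict A, T x = T' x := by
  have h1 : ApproximatesLinearOn (fun x => f x - f x) (0 : Euc n →L[ℝ] Euc n) A 0 :=
    fun x _ y _ => by simp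
  have h2 := h1.norm_fderiv_sub_le (volume : Measure (Euc n)) hA (fun x => T x - T' x)
    fun x hx => (h x hx).sub (h' x hx)
  filter_upwards [h2] with x hx
  have : ‖T x - T' x‖₊ = 0 := le_antisymm (by simpa using hx) zero_le
  exact sub_eq_zero.1 (nnnorm_eq_zero.1 this)

lemma LocallyIntegrableOn.of_norm_le {n : ℕ} {F F' : Type*} [NormedAddCommGroup F]
    [NormedAddCommGroup F'] {f : Euc n → F} {Ω : Set (Euc n)} (hf : LocallyIntegrableOn f Ω)
    {L : F → F'} (hL : Continuous L) {c : ℝ} (hc : ∀ y, ‖L y‖ ≤ c * ‖y‖) :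
    LocallyIntegrableOn (fun x => L (f x)) Ω := fun x hx => by
  obtain ⟨s, hs, hfs⟩ := hf x hx
  exact ⟨s, hs, (hfs.norm.const_mul c).mono' (hL.comp_aestronglyMeasurable hfs.1)
    (Eventually.of_forall fun y => hc _)⟩

lemma HasWeakGradientOn.smul_const {n : ℕ} {u : Euc n → ℝ} {g : Euc n → Euc n} {Ω : Set (Euc n)}
    (h : HasWeakGradientOn u g Ω) (e : Euc n) :
    HasWeakDerivOn (fun x => u x • e) (fun x => (innerSL ℝ (g x)).smulRight e) Ω := by
  refine ⟨LocallyIntegrableOn.of_norm_le h.1 (L := fun t : ℝ => t • e) (by fun_prop) (c := ‖e‖)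
    fun y => by rw [norm_smul, mul_comm],
    LocallyIntegrableOn.of_norm_le h.2.1 (L := fun y => (innerSL ℝ y).smulRight e) ?_ (c := ‖e‖)
    fun y => ?_, fun η hη hc hs v => ?_⟩
  · exact (ContinuousLinearMap.smulRightL ℝ (Euc n) (Euc n)).continuous.clm_apply
      continuous_const |>.comp (innerSL ℝ).continuous
  · rw [ContinuousLinearMap.norm_smulRight_apply, innerSL_apply_norm, mul_comm]
  · have h1 := h.2.2 η hη hc hs v
    have e1 : ∀ x, fderiv ℝ η x v • u x • e = (u x * fderiv ℝ η x v) • e := fun x => by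
      rw [smul_smul, mul_comm]
    have e2 : ∀ x, η x • ((innerSL ℝ (g x)).smulRight e) v = (⟪g x, v⟫ * η x) • e := fun x => by
      rw [ContinuousLinearMap.smulRight_apply, innerSL_apply_apply, smul_smul, mul_comm]
    simp only [e1, e2]
    rw [integral_smul_const, integral_smul_const, h1, neg_smul]

lemma HasWeakGradientOn.comp_inner_eq {n : ℕ} {Ω : Set (Euc n)} (hΩ : IsOpen Ω)
    {φ : Euc n → Euc n} (hφc : ContinuousOn φ Ω) {D : Euc n → Euc n →L[ℝ] Euc n}
    (hφ : HasWeakDerivOn φ D Ω) {f : Euc n → ℝ} (hf : ContDiff ℝ 1 f) {g : Euc n → Euc n}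
    (hg : HasWeakGradientOn (f ∘ φ) g Ω) {e : Euc n} (he : e ≠ 0) :
    ∀ᵐ x ∂volume.restrict Ω, ∀ w, ⟪g x, w⟫ = fderiv ℝ f (φ x) (D x w) := by
  obtain ⟨E, hEm, hEΩ, hE0, hE⟩ := exists_countable_cover_hasFDerivWithinAt hΩ hφ hφc
  obtain ⟨F, hFm, hFΩ, hF0, hF⟩ := exists_countable_cover_hasFDerivWithinAt hΩ
    (hg.smul_const e) ((hf.continuous.comp_continuousOn hφc).smul continuousOn_const)
  have hloc : ∀ k l, ∀ᵐ x ∂volume.restrict (E k ∩ F l),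
      (innerSL ℝ (g x)).smulRight e = ((fderiv ℝ f (φ x)).comp (D x)).smulRight e := fun k l => by
    refine ae_eq_of_hasFDerivWithinAt ((hEm k).inter (hFm l)) (f := fun x => (f ∘ φ) x • e)
      (fun x hx => (hF l x hx.2).mono inter_subset_right) fun x hx => ?_
    exact (((hf.differentiable one_ne_zero (φ x)).hasFDerivAt.comp_hasFDerivWithinAt x
      ((hE k x hx.1).mono inter_subset_left)).smul_const e)
  have hcover : volume (Ω \ ⋃ p : ℕ × ℕ, E p.1 ∩ F p.2) = 0 := by
    refine measure_mono_null (t := (Ω \ ⋃ k, E k) ∪ (Ω \ ⋃ k, F k)) (fun x hx => ?_)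
      (measure_union_null hE0 hF0)
    by_cases hE' : x ∈ ⋃ k, E k
    · by_cases hF' : x ∈ ⋃ k, F k
      · obtain ⟨k, hk⟩ := mem_iUnion.1 hE'
        obtain ⟨l, hl⟩ := mem_iUnion.1 hF'
        exact (hx.2 (mem_iUnion.2 ⟨(k, l), hk, hl⟩)).elim
      · exact Or.inr ⟨hx.1, hF'⟩
    · exact Or.inl ⟨hx.1, hE'⟩
  have hall : ∀ᵐ x ∂volume.restrict (⋃ p : ℕ × ℕ, E p.1 ∩ F p.2),
      (innerSL ℝ (g x)).smulRight e = ((fderiv ℝ f (φ x)).comp (D x)).smulRight e :=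
    (ae_restrict_iUnion_iff _ _).2 fun p => hloc p.1 p.2
  have hΩall : ∀ᵐ x ∂volume.restrict Ω,
      (innerSL ℝ (g x)).smulRight e = ((fderiv ℝ f (φ x)).comp (D x)).smulRight e := by
    refine ae_restrict_of_ae_restrict_of_subset (t := (⋃ p : ℕ × ℕ, E p.1 ∩ F p.2) ∪
      (Ω \ ⋃ p : ℕ × ℕ, E p.1 ∩ F p.2)) (fun x hx => ?_) ?_
    · by_cases h : x ∈ ⋃ p : ℕ × ℕ, E p.1 ∩ F p.2
      · exact Or.inl h
      · exact Or.inr ⟨hx, h⟩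
    · rw [ae_restrict_union_iff]
      refine ⟨hall, ?_⟩
      rw [Measure.restrict_eq_zero.2 hcover]
      simp
  filter_upwards [hΩall] with x hx w
  have := congrArg (fun T : Euc n →L[ℝ] Euc n => T w) hx
  simp only [ContinuousLinearMap.smulRight_apply, innerSL_apply_apply,
    ContinuousLinearMap.comp_apply] at this
  exact smul_left_injective ℝ he this

lemma hasWeakGradientOn_of_contDiff {n : ℕ} {f : Euc n → ℝ} (hf : ContDiff ℝ 1 f)
    (U : Set (Euc n)) : HasWeakGradientOn f (gradient f) U := by
  have hg : Continuous (gradient f) :=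
    (InnerProductSpace.toDual ℝ (Euc n)).symm.continuous.comp (hf.continuous_fderiv one_ne_zero)
  refine ⟨hf.continuous.locallyIntegrable.locallyIntegrableOn _,
    hg.locallyIntegrable.locallyIntegrableOn _, fun η hη hc hU v => ?_⟩
  have h1 : ∀ x, ⟪gradient f x, v⟫ = fderiv ℝ f x v := fun x => by
    rw [gradient, InnerProductSpace.toDual_symm_apply]
  have e1 : ∀ x, f x * fderiv ℝ η x v = fderiv ℝ η x v • f x := fun x => mul_comm _ _
  have e2 : ∀ x, ⟪gradient f x, v⟫ * η x = η x • fderiv ℝ f x v := fun x => by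
    rw [h1, smul_eq_mul, mul_comm]
  simp only [e1, e2]
  rw [setIntegral_fderiv_eq_integral_of_tsupport hU, setIntegral_eq_integral_of_tsupport hU]
  exact integral_fderiv_smul_eq hf (hη.of_le (by simp)) hc v

lemma enorm_gradient {n : ℕ} (f : Euc n → ℝ) (x : Euc n) :
    ‖gradient f x‖ₑ = ‖fderiv ℝ f x‖ₑ := by
  rw [gradient, ← ofReal_norm, ← ofReal_norm, LinearIsometryEquiv.norm_map]

lemma HasCompactSupport.lintegral_enorm_fderiv_rpow_ne_top {n : ℕ} {f : Euc n → ℝ}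
    (hc : HasCompactSupport f) (hf : ContDiff ℝ 1 f) {p : ℝ} (hp : 0 < p) :
    ∫⁻ x, ‖fderiv ℝ f x‖ₑ ^ p ≠ ∞ := by
  have hcont := hf.continuous_fderiv one_ne_zero
  have := (hcont.memLp_of_hasCompactSupport (hc.fderiv ℝ) (μ := volume)
    (p := ENNReal.ofReal p))
  have h2 := lintegral_rpow_enorm_lt_top_of_eLpNorm_lt_top (by simpa using hp) (by simp) this.2
  rw [ENNReal.toReal_ofReal hp.le] at h2
  exact h2.ne

lemma IsCompOpBddWith.exists_weakGradient {n : ℕ} (hn : 2 ≤ n) {Ω Ω' : Set (Euc n)}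
    {φ : Euc n → Euc n} {q : ℝ} (hq : 1 ≤ q) {K : ℝ≥0∞}
    (h : IsCompOpBddWith Ω Ω' φ (n : ℝ≥0∞) (ENNReal.ofReal q) K)
    {f : Euc n → ℝ} (hf : ContDiff ℝ 1 f) (hc : HasCompactSupport f) :
    ∃ g : Euc n → Euc n, HasWeakGradientOn (f ∘ φ) g Ω ∧
      (∫⁻ x in Ω, ‖g x‖ₑ ^ q) ^ (1 / q) ≤
        K * (∫⁻ x in Ω', ‖fderiv ℝ f x‖ₑ ^ (n : ℝ)) ^ (1 / (n : ℝ)) := by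
  have hn0 : (0 : ℝ) < n := by positivity
  have key : ∀ Ω' : Set (Euc n), lpNormE (fun x => (‖gradient f x‖₊ : ℝ≥0∞)) (n : ℝ≥0∞)
      (volume.restrict Ω') = (∫⁻ x in Ω', ‖fderiv ℝ f x‖ₑ ^ (n : ℝ)) ^ (1 / (n : ℝ)) := fun Ω' => by
    rw [lpNormE, if_neg (by simp)]
    simp only [ENNReal.toReal_natCast, ← enorm_eq_nnnorm, enorm_gradient]
  obtain ⟨g, hg, hgK⟩ := h f (gradient f) (hasWeakGradientOn_of_contDiff hf Ω') <| by
    rw [key]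
    refine ENNReal.rpow_ne_top_of_nonneg (by positivity) (ne_top_of_le_ne_top
      (hc.lintegral_enorm_fderiv_rpow_ne_top hf hn0) (setLIntegral_le_lintegral _ _))
  refine ⟨g, hg, ?_⟩
  rw [key, lpNormE, if_neg (by simp), ENNReal.toReal_ofReal (by linarith)] at hgK
  exact hgK

lemma HasWeakDerivOn.add {n : ℕ} {f f' : Euc n → Euc n} {G G' : Euc n → Euc n →L[ℝ] Euc n}
    {U : Set (Euc n)} (h : HasWeakDerivOn f G U) (h' : HasWeakDerivOn f' G' U) :
    HasWeakDerivOn (fun x => f x + f' x) (fun x => G x + G' x) U := by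
  have h0 := (hasWeakDerivOn_of_contDiff (f := fun _ : Euc n => (0 : Euc n)) contDiff_const U)
  simpa using h.sub (h0.sub h')

lemma HasWeakDerivOn.sum {n : ℕ} {ι : Type*} (s : Finset ι) {f : ι → Euc n → Euc n}
    {G : ι → Euc n → Euc n →L[ℝ] Euc n} {U : Set (Euc n)}
    (h : ∀ i, HasWeakDerivOn (f i) (G i) U) :
    HasWeakDerivOn (fun x => ∑ i ∈ s, f i x) (fun x => ∑ i ∈ s, G i x) U := by
  induction s using Finset.induction_on with
  | empty =>
    have e : fderiv ℝ (fun _ : Euc n => (0 : Euc n)) = fun _ => 0 := by ext; simp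
    have := hasWeakDerivOn_of_contDiff (f := fun _ : Euc n => (0 : Euc n)) contDiff_const U
    rw [e] at this
    simpa only [Finset.sum_empty] using this
  | insert i s hi ih => simpa only [Finset.sum_insert hi] using (h i).add ih

lemma HasWeakDerivOn.congr {n : ℕ} {f f' : Euc n → Euc n} {G G' : Euc n → Euc n →L[ℝ] Euc n}
    {U : Set (Euc n)} (hU : IsOpen U) (h : HasWeakDerivOn f G U) (hf : ∀ x ∈ U, f x = f' x)
    (hG : ∀ᵐ x ∂volume.restrict U, G x = G' x) : HasWeakDerivOn f' G' U := by
  have hfae : ∀ᵐ x ∂volume.restrict U, f x = f' x := (ae_restrict_iff' hU.measurableSet).2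
    (Eventually.of_forall hf)
  have aux : ∀ {F : Type _} [NormedAddCommGroup F] {u u' : Euc n → F}, LocallyIntegrableOn u U →
      (∀ᵐ x ∂volume.restrict U, u x = u' x) → LocallyIntegrableOn u' U := by
    intro F _ u u' hu huu x hx
    obtain ⟨s, hs, hus⟩ := hu x hx
    refine ⟨s ∩ U, inter_mem hs self_mem_nhdsWithin, (hus.mono_set inter_subset_left).congr ?_⟩
    exact ae_restrict_of_ae_restrict_of_subset inter_subset_right huu
  refine ⟨aux h.1 hfae, aux h.2.1 hG, fun η hη hc hs v => ?_⟩
  have := h.2.2 η hη hc hs v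
  rwa [integral_congr_ae (hfae.mono fun x hx => by simp only [hx] :
      (fun x => fderiv ℝ η x v • f x) =ᵐ[volume.restrict U] fun x => fderiv ℝ η x v • f' x),
    integral_congr_ae (hG.mono fun x hx => by simp only [hx] :
      (fun x => η x • G x v) =ᵐ[volume.restrict U] fun x => η x • G' x v)] at this

lemma HasWeakDerivOn.ae_eq {n : ℕ} {f : Euc n → Euc n} {G G' : Euc n → Euc n →L[ℝ] Euc n}
    {U : Set (Euc n)} (hU : IsOpen U) (h : HasWeakDerivOn f G U) (h' : HasWeakDerivOn f G' U) :
    ∀ᵐ x ∂volume, x ∈ U → G x = G' x := by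
  have h0 := h.sub h'
  have key : ∀ v, ∀ᵐ x ∂volume, x ∈ U → (G x - G' x) v = 0 := fun v => by
    refine hU.ae_eq_zero_of_integral_contDiff_smul_eq_zero
      (LocallyIntegrableOn.of_norm_le h0.2.1 (L := fun T : Euc n →L[ℝ] Euc n => T v) (by fun_prop) (c := ‖v‖)
        fun T => by rw [mul_comm]; exact T.le_opNorm v) fun η hη hc hs => ?_
    have := h0.2.2 η hη hc hs v
    simp only [sub_self, smul_zero, integral_zero] at this
    rw [← setIntegral_eq_integral_of_tsupport hs]
    exact neg_eq_zero.1 this.symm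
  have hall := ae_all_iff.2 fun i : Fin n => key (EuclideanSpace.basisFun (Fin n) ℝ i)
  filter_upwards [hall] with x hx hxU
  have : (G x - G' x : Euc n →L[ℝ] Euc n).toLinearMap = 0 :=
    (EuclideanSpace.basisFun (Fin n) ℝ).toBasis.ext fun i => by simpa using hx i hxU
  exact sub_eq_zero.1 (ContinuousLinearMap.coe_injective this)

lemma exists_hasWeakDerivOn_of_monotone_cover {n : ℕ} {f : Euc n → Euc n} {Ω : Set (Euc n)}
    {U : ℕ → Set (Euc n)} (hU : ∀ k, IsOpen (U k)) (hmono : Monotone U) (hΩ : ⋃ k, U k = Ω)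
    {G : ℕ → Euc n → Euc n →L[ℝ] Euc n} (h : ∀ k, HasWeakDerivOn f (G k) (U k)) :
    ∃ D, HasWeakDerivOn f D Ω := by
  set N : Euc n → ℕ := fun x => sInf {k | x ∈ U k}
  have hagree : ∀ᵐ x ∂volume, ∀ k i, i ≤ k → x ∈ U i → G i x = G k x := by
    simp only [ae_all_iff]
    exact fun k i hik => (h i).ae_eq (hU i) ((h k).mono (hmono hik))
  have hD : ∀ k, HasWeakDerivOn f (fun x => G (N x) x) (U k) := fun k => by
    refine (h k).congr (hU k) (fun _ _ => rfl) ((ae_restrict_iff' (hU k).measurableSet).2 ?_)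
    filter_upwards [hagree] with x hx hxk
    exact (hx k (N x) (Nat.sInf_le hxk) (Nat.sInf_mem (s := {k | x ∈ U k}) ⟨k, hxk⟩)).symm
  have hloc : ∀ {F : Type _} [NormedAddCommGroup F] {u : Euc n → F},
      (∀ k, LocallyIntegrableOn u (U k)) → LocallyIntegrableOn u Ω := by
    intro F _ u hu x hx
    obtain ⟨k, hk⟩ := mem_iUnion.1 (hΩ.symm ▸ hx)
    have := hu k x hk
    rw [(hU k).nhdsWithin_eq hk] at this
    exact this.filter_mono nhdsWithin_le_nhds
  refine ⟨fun x => G (N x) x, hloc fun k => (h k).1, hloc fun k => (hD k).2.1,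
    fun η hη hc hs v => ?_⟩
  obtain ⟨k, hk⟩ := hc.isCompact.elim_directed_cover U hU (hΩ.symm ▸ hs) hmono.directed_le
  have := (hD k).2.2 η hη hc hk v
  rwa [setIntegral_fderiv_eq_integral_of_tsupport hk, setIntegral_eq_integral_of_tsupport hk,
    ← setIntegral_fderiv_eq_integral_of_tsupport hs,
    ← setIntegral_eq_integral_of_tsupport hs] at this

lemma IsCompOpBddWith.exists_hasWeakDerivOn {n : ℕ} (hn : 2 ≤ n) {Ω Ω' : Set (Euc n)}
    (hΩ : IsOpen Ω) {φ : Euc n → Euc n} (hφ : ContinuousOn φ Ω) {q : ℝ} (hq : 1 ≤ q) {K : ℝ≥0∞}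
    (h : IsCompOpBddWith Ω Ω' φ (n : ℝ≥0∞) (ENNReal.ofReal q) K) :
    ∃ D, HasWeakDerivOn φ D Ω := by
  obtain ⟨f, hf, hc, hf1⟩ : ∃ f : ℕ → Fin n → Euc n → ℝ, (∀ k j, ContDiff ℝ 1 (f k j)) ∧
      (∀ k j, HasCompactSupport (f k j)) ∧
      ∀ (k : ℕ) j, ∀ y, ‖y‖ < (k : ℝ) + 1 → f k j y = y j := by
    let χ : ℕ → ContDiffBump (0 : Euc n) := fun k => ⟨k + 1, k + 2, by positivity, by linarith⟩
    refine ⟨fun (k : ℕ) j y => χ k y * y j, fun k j => ?_, fun k j =>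
      (χ k).hasCompactSupport.mul_right, fun (k : ℕ) j y hy => ?_⟩
    · have : ContDiff ℝ 1 fun y : Euc n => y j := (EuclideanSpace.proj (𝕜 := ℝ) j).contDiff
      exact (χ k).contDiff.mul this
    · simp only [(χ k).one_of_mem_closedBall (mem_closedBall_zero_iff.2 hy.le), one_mul]
  have hex : ∀ k j, ∃ g, HasWeakGradientOn (f k j ∘ φ) g Ω := fun k j =>
    (h.exists_weakGradient hn hq (hf k j) (hc k j)).imp fun _ hg => hg.1
  choose g hg using hex
  obtain ⟨U, hU, hUx⟩ : ∃ U : ℕ → Set (Euc n), (∀ k, IsOpen (U k)) ∧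
      ∀ (k : ℕ) x, x ∈ U k ↔ x ∈ Ω ∧ ‖φ x‖ < (k : ℝ) + 1 :=
    ⟨fun k => Ω ∩ φ ⁻¹' ball 0 ((k : ℝ) + 1), fun k => hφ.isOpen_inter_preimage hΩ isOpen_ball,
      fun k x => by simp⟩
  refine exists_hasWeakDerivOn_of_monotone_cover hU (fun k l hkl x hx => ?_) ?_
    (G := fun k x => ∑ j, (innerSL ℝ (g k j x)).smulRight (EuclideanSpace.basisFun (Fin n) ℝ j))
    fun k => ?_
  · have hkl' : (k : ℝ) + 1 ≤ l + 1 := by gcongr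
    rw [hUx] at hx ⊢
    exact ⟨hx.1, hx.2.trans_le hkl'⟩
  · ext x
    simp only [mem_iUnion, hUx]
    refine ⟨fun ⟨_, h, _⟩ => h, fun hx => ?_⟩
    obtain ⟨k, hk⟩ := exists_nat_gt ‖φ x‖
    exact ⟨k, hx, by linarith⟩
  · refine (HasWeakDerivOn.sum Finset.univ fun j => ((hg k j).smul_const
      (EuclideanSpace.basisFun (Fin n) ℝ j)).mono fun x hx => ((hUx k x).1 hx).1).congr (hU k)
      (fun x hx => ?_) (Eventually.of_forall fun _ => rfl)
    have h2 := (EuclideanSpace.basisFun (Fin n) ℝ).sum_repr (φ x)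
    simp only [Function.comp_apply, hf1 k _ _ ((hUx k x).1 hx).2]
    simpa using h2

lemma aestronglyMeasurable_fderiv_comp {n : ℕ} {μ : Measure (Euc n)} {f : Euc n → ℝ}
    (hf : ContDiff ℝ 1 f) {φ : Euc n → Euc n} (hφ : AEStronglyMeasurable φ μ)
    {D : Euc n → Euc n →L[ℝ] Euc n} (hD : AEStronglyMeasurable D μ) :
    AEStronglyMeasurable (fun x => (fderiv ℝ f (φ x)).comp (D x)) μ :=
  (isBoundedBilinearMap_comp (𝕜 := ℝ) (E := Euc n) (F := Euc n)
    (G := ℝ)).continuous.comp_aestronglyMeasurable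
    (((hf.continuous_fderiv one_ne_zero).comp_aestronglyMeasurable hφ).prodMk hD)

lemma HasWeakGradientOn.ae_enorm_comp_eq {n : ℕ} (hn : 2 ≤ n) {Ω : Set (Euc n)} (hΩ : IsOpen Ω)
    {φ : Euc n → Euc n} (hφc : ContinuousOn φ Ω) {D : Euc n → Euc n →L[ℝ] Euc n}
    (hφ : HasWeakDerivOn φ D Ω) {f : Euc n → ℝ} (hf : ContDiff ℝ 1 f) {g : Euc n → Euc n}
    (hg : HasWeakGradientOn (f ∘ φ) g Ω) :
    ∀ᵐ x ∂volume.restrict Ω, ‖g x‖ₑ = ‖(fderiv ℝ f (φ x)).comp (D x)‖ₑ := by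
  have he : EuclideanSpace.basisFun (Fin n) ℝ ⟨0, by omega⟩ ≠ 0 := fun h => by
    simpa [h] using (EuclideanSpace.basisFun (Fin n) ℝ).norm_eq_one ⟨0, by omega⟩
  filter_upwards [hg.comp_inner_eq hΩ hφc hφ hf he] with x hx
  have : innerSL ℝ (g x) = (fderiv ℝ f (φ x)).comp (D x) := by
    ext w
    simpa using hx w
  rw [← this, ← ofReal_norm, ← ofReal_norm, innerSL_apply_norm]

lemma IsHomeoOn.isCompact_inter_preimage {n : ℕ} {φ : Euc n → Euc n} {Ω Ω' P : Set (Euc n)}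
    (h : IsHomeoOn φ Ω Ω') (hP : IsCompact P) (hPΩ : P ⊆ Ω') : IsCompact (Ω ∩ φ ⁻¹' P) := by
  have : Function.invFunOn φ Ω '' P = Ω ∩ φ ⁻¹' P := by
    have hinv := h.1.invOn_invFunOn
    have hmaps := h.1.surjOn.mapsTo_invFunOn
    ext x
    constructor
    · rintro ⟨y, hy, rfl⟩
      exact ⟨hmaps (hPΩ hy), by rwa [mem_preimage, hinv.2 (hPΩ hy)]⟩
    · exact fun hx => ⟨φ x, hx.2, hinv.1 hx.1⟩
  rw [← this]
  exact hP.image_of_continuousOn (h.2.2.mono hPΩ)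

lemma lintegral_fderiv_comp_eq_of_tsupport {n : ℕ} {Ω P : Set (Euc n)} {φ : Euc n → Euc n}
    {f : Euc n → ℝ} (hfP : tsupport f ⊆ P) (D : Euc n → Euc n →L[ℝ] Euc n)
    (hm : MeasurableSet (Ω ∩ φ ⁻¹' P)) (hΩ : MeasurableSet Ω) :
    ∫⁻ x in Ω, ‖(fderiv ℝ f (φ x)).comp (D x)‖ₑ =
      ∫⁻ x in Ω ∩ φ ⁻¹' P, ‖(fderiv ℝ f (φ x)).comp (D x)‖ₑ := by
  rw [← lintegral_inter_add_sdiff _ Ω hm, inter_eq_self_of_subset_right inter_subset_left,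
    setLIntegral_eq_zero (hΩ.diff hm) fun x hx => ?_, add_zero]
  have : fderiv ℝ f (φ x) = 0 := image_eq_zero_of_notMem_tsupport fun h =>
    hx.2 ⟨hx.1, hfP (tsupport_fderiv_subset ℝ h)⟩
  rw [this, ContinuousLinearMap.zero_comp]
  rw [← ofReal_norm, norm_zero, ENNReal.ofReal_zero, Pi.zero_apply]

lemma IsCompOpBddWith.exists_lintegral_fderiv_comp_le {n : ℕ} (hn : 2 ≤ n) {Ω Ω' : Set (Euc n)}
    (hΩ : IsOpen Ω) {φ : Euc n → Euc n} (hφ : IsHomeoOn φ Ω Ω') {q : ℝ} (hq : 1 ≤ q)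
    {K : ℝ≥0∞} (hK : K ≠ ∞) (h : IsCompOpBddWith Ω Ω' φ (n : ℝ≥0∞) (ENNReal.ofReal q) K)
    {D : Euc n → Euc n →L[ℝ] Euc n} (hD : HasWeakDerivOn φ D Ω) {P : Set (Euc n)}
    (hP : IsCompact P) (hPΩ : P ⊆ Ω') :
    ∃ C : ℝ≥0∞, C ≠ ∞ ∧ ∀ f : Euc n → ℝ, ContDiff ℝ 1 f → tsupport f ⊆ P →
      ∫⁻ x in Ω, ‖(fderiv ℝ f (φ x)).comp (D x)‖ₑ ≤
        C * (∫⁻ y, ‖fderiv ℝ f y‖ₑ ^ (n : ℝ)) ^ (1 / (n : ℝ)) := by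
  have hQ := hφ.isCompact_inter_preimage hP hPΩ
  have hq0 : 0 ≤ 1 / (1 : ℝ) - 1 / q := by
    rw [one_div_one, sub_nonneg]
    exact (div_le_one (by linarith)).2 hq
  refine ⟨K * volume (Ω ∩ φ ⁻¹' P) ^ (1 / (1 : ℝ) - 1 / q), ENNReal.mul_ne_top hK
    (ENNReal.rpow_ne_top_of_nonneg hq0 hQ.measure_lt_top.ne), fun f hf hfP => ?_⟩
  have hc : HasCompactSupport f := hP.of_isClosed_subset (isClosed_tsupport f) hfP
  obtain ⟨g, hg, hgK⟩ := h.exists_weakGradient hn hq hf hc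
  have hae := hg.ae_enorm_comp_eq hn hΩ hφ.2.1 hD hf
  have hmeas : AEStronglyMeasurable (fun x => (fderiv ℝ f (φ x)).comp (D x))
      (volume.restrict Ω) := aestronglyMeasurable_fderiv_comp hf
    (hφ.2.1.aestronglyMeasurable hΩ.measurableSet) hD.2.1.aestronglyMeasurable
  rw [lintegral_fderiv_comp_eq_of_tsupport hfP D hQ.measurableSet hΩ.measurableSet]
  have h1 := eLpNorm'_le_eLpNorm'_mul_rpow_measure_univ (μ := volume.restrict (Ω ∩ φ ⁻¹' P))
    zero_lt_one hq (hmeas.mono_set inter_subset_left)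
  simp only [eLpNorm', ENNReal.rpow_one, div_one, Measure.restrict_apply_univ] at h1
  refine h1.trans ?_
  rw [mul_right_comm, one_div_one]
  gcongr
  calc _ ≤ (∫⁻ x in Ω, ‖(fderiv ℝ f (φ x)).comp (D x)‖ₑ ^ q) ^ (1 / q) := by
        gcongr
        exact inter_subset_left
    _ = (∫⁻ x in Ω, ‖g x‖ₑ ^ q) ^ (1 / q) := by
        congr 1
        exact lintegral_congr_ae (hae.mono fun x hx => by simp only [hx])
    _ ≤ _ := hgK
    _ ≤ _ := by
        gcongr
        exact Measure.restrict_le_self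

lemma norm_le_sum_norm_proj_comp {n : ℕ} (T : Euc n →L[ℝ] Euc n) :
    ‖T‖ ≤ ∑ j, ‖(EuclideanSpace.proj j : Euc n →L[ℝ] ℝ).comp T‖ := by
  refine T.opNorm_le_bound (Finset.sum_nonneg fun _ _ => norm_nonneg _) fun w => ?_
  have h1 := (EuclideanSpace.basisFun (Fin n) ℝ).sum_repr (T w)
  rw [← h1, Finset.sum_mul]
  refine (norm_sum_le _ _).trans (Finset.sum_le_sum fun j _ => ?_)
  rw [norm_smul, (EuclideanSpace.basisFun (Fin n) ℝ).norm_eq_one, mul_one]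
  exact ((EuclideanSpace.proj j : Euc n →L[ℝ] ℝ).comp T).le_opNorm w

lemma fderiv_mul_osc {n : ℕ} {ρ : Euc n → ℝ} (hρ : ContDiff ℝ 1 ρ) (j : Fin n) {ε : ℝ}
    (hε : 0 < ε) {a b : ℝ → ℝ} (hab : ∀ t, HasDerivAt a (b t) t) (y : Euc n) :
    fderiv ℝ (fun y => ε * (ρ y * a (y j / ε))) y =
      (ε * a (y j / ε)) • fderiv ℝ ρ y +
        (ρ y * b (y j / ε)) • (EuclideanSpace.proj j : Euc n →L[ℝ] ℝ) := by
  have h1 : HasFDerivAt (fun y : Euc n => y j / ε)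
      (ε⁻¹ • (EuclideanSpace.proj j : Euc n →L[ℝ] ℝ)) y := by
    have := (EuclideanSpace.proj j : Euc n →L[ℝ] ℝ).hasFDerivAt (x := y) |>.const_smul ε⁻¹
    refine this.congr_of_eventuallyEq (Eventually.of_forall fun z => ?_)
    simp [div_eq_inv_mul]
  have h2 := (hab (y j / ε)).comp_hasFDerivAt y h1
  have h3 := ((hρ.differentiable one_ne_zero y).hasFDerivAt.mul h2).const_mul ε
  refine h3.fderiv.trans ?_
  ext w
  simp
  field_simp
  ring

lemma lintegral_rpow_osc_le {n : ℕ} (hn : 2 ≤ n) {ρ : Euc n → ℝ} (hρ : ContDiff ℝ 1 ρ)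
    (j : Fin n) {ε : ℝ} (hε : 0 < ε) {a b : ℝ → ℝ} (hab : ∀ t, HasDerivAt a (b t) t)
    (ha : ∀ t, |a t| ≤ 1) (hb : ∀ t, |b t| ≤ 1) :
    (∫⁻ y, ‖fderiv ℝ (fun y => ε * (ρ y * a (y j / ε))) y‖ₑ ^ (n : ℝ)) ^ (1 / (n : ℝ)) ≤
      ENNReal.ofReal ε * (∫⁻ y, ‖fderiv ℝ ρ y‖ₑ ^ (n : ℝ)) ^ (1 / (n : ℝ)) +
        (∫⁻ y, ‖ρ y‖ₑ ^ (n : ℝ)) ^ (1 / (n : ℝ)) := by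
  have hn1 : (1 : ℝ) ≤ n := by exact_mod_cast (by omega : 1 ≤ n)
  have hn0 : (0 : ℝ) < n := by linarith
  have hpt : ∀ y, ‖fderiv ℝ (fun y => ε * (ρ y * a (y j / ε))) y‖ₑ ≤
      ENNReal.ofReal ε * ‖fderiv ℝ ρ y‖ₑ + ‖ρ y‖ₑ := fun y => by
    rw [fderiv_mul_osc hρ j hε hab]
    have hp : ‖(EuclideanSpace.proj j : Euc n →L[ℝ] ℝ)‖ ≤ 1 :=
      ContinuousLinearMap.opNorm_le_bound _ zero_le_one fun w => by
        rw [one_mul]; exact PiLp.norm_apply_le w j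
    rw [← ofReal_norm, ← ofReal_norm, ← ofReal_norm, ← ENNReal.ofReal_mul hε.le,
      ← ENNReal.ofReal_add (by positivity) (norm_nonneg _)]
    refine ENNReal.ofReal_le_ofReal ((norm_add_le _ _).trans ?_)
    rw [norm_smul, norm_smul, norm_mul, norm_mul, Real.norm_eq_abs ε, abs_of_pos hε]
    refine add_le_add ?_ ?_
    · have := ha (y j / ε)
      rw [← Real.norm_eq_abs] at this
      calc _ ≤ ε * 1 * ‖fderiv ℝ ρ y‖ := by gcongr
        _ = _ := by ring
    · have := hb (y j / ε)
      rw [← Real.norm_eq_abs] at this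
      calc _ ≤ ‖ρ y‖ * 1 * 1 := by gcongr
        _ = _ := by ring
  have hm1 : Measurable fun y => ENNReal.ofReal ε * ‖fderiv ℝ ρ y‖ₑ :=
    (hρ.continuous_fderiv one_ne_zero).enorm.measurable.const_mul _
  calc _ ≤ (∫⁻ y, (ENNReal.ofReal ε * ‖fderiv ℝ ρ y‖ₑ + ‖ρ y‖ₑ) ^ (n : ℝ)) ^ (1 / (n : ℝ)) := by
        gcongr with y
        exact hpt y
    _ ≤ (∫⁻ y, (ENNReal.ofReal ε * ‖fderiv ℝ ρ y‖ₑ) ^ (n : ℝ)) ^ (1 / (n : ℝ)) +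
        (∫⁻ y, ‖ρ y‖ₑ ^ (n : ℝ)) ^ (1 / (n : ℝ)) :=
      ENNReal.lintegral_Lp_add_le hm1.aemeasurable hρ.continuous.enorm.measurable.aemeasurable hn1
    _ = _ := by
      congr 1
      simp only [ENNReal.mul_rpow_of_nonneg _ _ hn0.le]
      rw [lintegral_const_mul _ (by fun_prop), ENNReal.mul_rpow_of_nonneg _ _ (by positivity),
        ← ENNReal.rpow_mul, mul_one_div_cancel hn0.ne', ENNReal.rpow_one]

lemma enorm_mul_proj_comp_le {n : ℕ} {ρ : Euc n → ℝ} (hρ : ContDiff ℝ 1 ρ) (j : Fin n) {ε : ℝ}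
    (hε : 0 < ε) (T : Euc n →L[ℝ] Euc n) (y : Euc n) :
    ‖ρ y‖ₑ * ‖(EuclideanSpace.proj j : Euc n →L[ℝ] ℝ).comp T‖ₑ ≤
      ‖(fderiv ℝ (fun y => ε * (ρ y * Real.sin (y j / ε))) y).comp T‖ₑ +
      (‖(fderiv ℝ (fun y => ε * (ρ y * Real.cos (y j / ε))) y).comp T‖ₑ +
        ENNReal.ofReal (2 * ε) * ‖(fderiv ℝ ρ y).comp T‖ₑ) := by
  rw [fderiv_mul_osc hρ j hε Real.hasDerivAt_sin, fderiv_mul_osc hρ j hε Real.hasDerivAt_cos]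
  set e := (EuclideanSpace.proj j : Euc n →L[ℝ] ℝ).comp T with he
  set w := (fderiv ℝ ρ y).comp T with hw
  set s := Real.sin (y j / ε)
  set c := Real.cos (y j / ε)
  have e1 : (((ε * s) • fderiv ℝ ρ y + (ρ y * c) • (EuclideanSpace.proj j : Euc n →L[ℝ] ℝ))).comp T
      = (ε * s) • w + (ρ y * c) • e := by ext; simp [hw, he]
  have e2 : (((ε * c) • fderiv ℝ ρ y + (ρ y * -s) • (EuclideanSpace.proj j : Euc n →L[ℝ] ℝ))).comp T
      = (ε * c) • w + (ρ y * -s) • e := by ext; simp [hw, he]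
  rw [e1, e2]
  simp only [← ofReal_norm]
  rw [← ENNReal.ofReal_mul (norm_nonneg _), ← ENNReal.ofReal_mul (by positivity),
    ← ENNReal.ofReal_add (by positivity) (by positivity),
    ← ENNReal.ofReal_add (by positivity) (by positivity)]
  refine ENNReal.ofReal_le_ofReal ?_
  have h1 : ‖(ρ y * c) • e‖ ≤ ‖(ε * s) • w + (ρ y * c) • e‖ + ‖(ε * s) • w‖ := by
    have := norm_sub_le ((ε * s) • w + (ρ y * c) • e) ((ε * s) • w)
    rwa [add_sub_cancel_left] at this
  have h2 : ‖(ρ y * -s) • e‖ ≤ ‖(ε * c) • w + (ρ y * -s) • e‖ + ‖(ε * c) • w‖ := by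
    have := norm_sub_le ((ε * c) • w + (ρ y * -s) • e) ((ε * c) • w)
    rwa [add_sub_cancel_left] at this
  have hs : |s| ≤ 1 := Real.abs_sin_le_one _
  have hc : |c| ≤ 1 := Real.abs_cos_le_one _
  have hsc : 1 ≤ |s| + |c| := by
    have h := Real.sin_sq_add_cos_sq (y j / ε)
    have h3 : |s| ^ 2 + |c| ^ 2 = 1 := by rw [sq_abs, sq_abs]; exact h
    nlinarith [abs_nonneg s, abs_nonneg c]
  simp only [norm_smul, norm_mul, norm_neg, Real.norm_eq_abs, abs_of_pos hε] at h1 h2 ⊢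
  have h4 : |ρ y| * ‖e‖ ≤ (|s| + |c|) * (|ρ y| * ‖e‖) := le_mul_of_one_le_left (by positivity) hsc
  have h5 : ε * |s| * ‖w‖ ≤ ε * 1 * ‖w‖ := by gcongr
  have h6 : ε * |c| * ‖w‖ ≤ ε * 1 * ‖w‖ := by gcongr
  nlinarith

lemma lintegral_enorm_mul_proj_comp_le {n : ℕ} (hn : 2 ≤ n) {Ω P : Set (Euc n)}
    {φ : Euc n → Euc n} (hφ : AEStronglyMeasurable φ (volume.restrict Ω))
    {D : Euc n → Euc n →L[ℝ] Euc n} (hD : AEStronglyMeasurable D (volume.restrict Ω))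
    {C : ℝ≥0∞} (hC : C ≠ ∞) (h : ∀ f : Euc n → ℝ, ContDiff ℝ 1 f → tsupport f ⊆ P →
      ∫⁻ x in Ω, ‖(fderiv ℝ f (φ x)).comp (D x)‖ₑ ≤
        C * (∫⁻ y, ‖fderiv ℝ f y‖ₑ ^ (n : ℝ)) ^ (1 / (n : ℝ)))
    {ρ : Euc n → ℝ} (hρ : ContDiff ℝ 1 ρ) (hρc : HasCompactSupport ρ) (hρP : tsupport ρ ⊆ P)
    (j : Fin n) :
    ∫⁻ x in Ω, ‖ρ (φ x)‖ₑ * ‖(EuclideanSpace.proj j : Euc n →L[ℝ] ℝ).comp (D x)‖ₑ ≤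
      2 * C * (∫⁻ y, ‖ρ y‖ₑ ^ (n : ℝ)) ^ (1 / (n : ℝ)) := by
  have hn0 : (0 : ℝ) < n := by positivity
  set A := (∫⁻ y, ‖ρ y‖ₑ ^ (n : ℝ)) ^ (1 / (n : ℝ))
  set B := (∫⁻ y, ‖fderiv ℝ ρ y‖ₑ ^ (n : ℝ)) ^ (1 / (n : ℝ)) with hB
  have hBt : B ≠ ∞ := ENNReal.rpow_ne_top_of_nonneg (by positivity)
    (hρc.lintegral_enorm_fderiv_rpow_ne_top hρ hn0)
  have hosc : ∀ ε : ℝ, 0 < ε → ∀ a : ℝ → ℝ, ContDiff ℝ 1 a →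
      ContDiff ℝ 1 (fun y : Euc n => ε * (ρ y * a (y j / ε))) ∧
      tsupport (fun y : Euc n => ε * (ρ y * a (y j / ε))) ⊆ P := fun ε hε a ha => by
    have : ContDiff ℝ 1 fun y : Euc n => y j / ε :=
      ((EuclideanSpace.proj (𝕜 := ℝ) j).contDiff : ContDiff ℝ 1 fun y : Euc n => y j).div_const ε
    refine ⟨contDiff_const.mul (hρ.mul (ha.comp this)), ?_⟩
    exact (closure_mono ((Function.support_mul_subset_right _ _).trans
      (Function.support_mul_subset_left _ _))).trans hρP
  have hε : ∀ ε : ℝ, 0 < ε →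
      ∫⁻ x in Ω, ‖ρ (φ x)‖ₑ * ‖(EuclideanSpace.proj j : Euc n →L[ℝ] ℝ).comp (D x)‖ₑ ≤
        2 * C * A + ENNReal.ofReal ε * (4 * C * B) := fun ε hε => by
    obtain ⟨hs1, hs2⟩ := hosc ε hε Real.sin Real.contDiff_sin
    obtain ⟨hc1, hc2⟩ := hosc ε hε Real.cos Real.contDiff_cos
    have hs3 := lintegral_rpow_osc_le hn hρ j hε Real.hasDerivAt_sin Real.abs_sin_le_one
      Real.abs_cos_le_one
    have hc3 := lintegral_rpow_osc_le hn hρ j hε Real.hasDerivAt_cos Real.abs_cos_le_one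
      (fun t => by rw [abs_neg]; exact Real.abs_sin_le_one t)
    calc _ ≤ ∫⁻ x in Ω, (‖(fderiv ℝ (fun y => ε * (ρ y * Real.sin (y j / ε))) (φ x)).comp (D x)‖ₑ +
      (‖(fderiv ℝ (fun y => ε * (ρ y * Real.cos (y j / ε))) (φ x)).comp (D x)‖ₑ +
        ENNReal.ofReal (2 * ε) * ‖(fderiv ℝ ρ (φ x)).comp (D x)‖ₑ)) :=
          lintegral_mono fun x => enorm_mul_proj_comp_le hρ j hε (D x) (φ x)
      _ = (∫⁻ x in Ω, ‖(fderiv ℝ (fun y => ε * (ρ y * Real.sin (y j / ε))) (φ x)).comp (D x)‖ₑ) +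
        ((∫⁻ x in Ω, ‖(fderiv ℝ (fun y => ε * (ρ y * Real.cos (y j / ε))) (φ x)).comp (D x)‖ₑ) +
          ENNReal.ofReal (2 * ε) * ∫⁻ x in Ω, ‖(fderiv ℝ ρ (φ x)).comp (D x)‖ₑ) := by
        rw [lintegral_add_left' (aestronglyMeasurable_fderiv_comp hs1 hφ hD).enorm,
          lintegral_add_left' (aestronglyMeasurable_fderiv_comp hc1 hφ hD).enorm,
          lintegral_const_mul' _ _ ENNReal.ofReal_ne_top]
      _ ≤ C * (ENNReal.ofReal ε * B + A) + (C * (ENNReal.ofReal ε * B + A) +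
          ENNReal.ofReal (2 * ε) * (C * B)) := by
        gcongr
        · exact (h _ hs1 hs2).trans (by gcongr)
        · exact (h _ hc1 hc2).trans (by gcongr)
        · exact h _ hρ hρP
      _ = _ := by
        rw [ENNReal.ofReal_mul two_pos.le, ENNReal.ofReal_ofNat]
        ring
  have hlim : Tendsto (fun ε : ℝ => 2 * C * A + ENNReal.ofReal ε * (4 * C * B)) (𝓝[>] 0)
      (𝓝 (2 * C * A + ENNReal.ofReal 0 * (4 * C * B))) := by
    have h1 : Tendsto (fun ε : ℝ => ENNReal.ofReal ε) (𝓝[>] 0) (𝓝 (ENNReal.ofReal 0)) :=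
      (ENNReal.continuous_ofReal.tendsto 0).mono_left nhdsWithin_le_nhds
    refine (ENNReal.Tendsto.mul_const h1 (Or.inr ?_)).const_add _
    exact ENNReal.mul_ne_top (ENNReal.mul_ne_top (by simp) hC) hBt
  have := ge_of_tendsto hlim (eventually_mem_nhdsWithin.mono hε)
  simpa using this

lemma lintegral_enorm_mul_enorm_deriv_le {n : ℕ} (hn : 2 ≤ n) {Ω P : Set (Euc n)}
    {φ : Euc n → Euc n} (hφ : AEStronglyMeasurable φ (volume.restrict Ω))
    {D : Euc n → Euc n →L[ℝ] Euc n} (hD : AEStronglyMeasurable D (volume.restrict Ω))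
    {C : ℝ≥0∞} (hC : C ≠ ∞) (h : ∀ f : Euc n → ℝ, ContDiff ℝ 1 f → tsupport f ⊆ P →
      ∫⁻ x in Ω, ‖(fderiv ℝ f (φ x)).comp (D x)‖ₑ ≤
        C * (∫⁻ y, ‖fderiv ℝ f y‖ₑ ^ (n : ℝ)) ^ (1 / (n : ℝ)))
    {ρ : Euc n → ℝ} (hρ : ContDiff ℝ 1 ρ) (hρc : HasCompactSupport ρ) (hρP : tsupport ρ ⊆ P) :
    ∫⁻ x in Ω, ‖ρ (φ x)‖ₑ * ‖D x‖ₑ ≤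
      2 * n * C * (∫⁻ y, ‖ρ y‖ₑ ^ (n : ℝ)) ^ (1 / (n : ℝ)) := by
  have hm : ∀ j : Fin n, AEMeasurable (fun x => ‖ρ (φ x)‖ₑ *
      ‖(EuclideanSpace.proj j : Euc n →L[ℝ] ℝ).comp (D x)‖ₑ) (volume.restrict Ω) := fun j =>
    (hρ.continuous.comp_aestronglyMeasurable hφ).enorm.mul
      ((ContinuousLinearMap.compL ℝ _ _ _ _).continuous.comp_aestronglyMeasurable hD).enorm
  calc _ ≤ ∫⁻ x in Ω, ∑ j : Fin n, ‖ρ (φ x)‖ₑ *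
        ‖(EuclideanSpace.proj j : Euc n →L[ℝ] ℝ).comp (D x)‖ₑ := by
        refine lintegral_mono fun x => ?_
        rw [← Finset.mul_sum]
        gcongr
        simp only [← ofReal_norm]
        rw [← ENNReal.ofReal_sum_of_nonneg fun _ _ => norm_nonneg _]
        exact ENNReal.ofReal_le_ofReal (norm_le_sum_norm_proj_comp _)
    _ = ∑ j : Fin n, ∫⁻ x in Ω, ‖ρ (φ x)‖ₑ *
        ‖(EuclideanSpace.proj j : Euc n →L[ℝ] ℝ).comp (D x)‖ₑ :=
      lintegral_finsetSum' _ fun j _ => hm j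
    _ ≤ ∑ j : Fin n, 2 * C * (∫⁻ y, ‖ρ y‖ₑ ^ (n : ℝ)) ^ (1 / (n : ℝ)) :=
      Finset.sum_le_sum fun j _ => lintegral_enorm_mul_proj_comp_le hn hφ hD hC h hρ hρc hρP j
    _ = _ := by
      rw [Finset.sum_const, Finset.card_univ, Fintype.card_fin, nsmul_eq_mul]
      ring

lemma exists_contDiff_tendsto_ae {n : ℕ} {W P : Set (Euc n)} (hW : IsCompact W)
    (hWP : W ⊆ interior P) {g : Euc n → ℝ} (hg : Measurable g) {M : ℝ} (hM : ∀ y, ‖g y‖ ≤ M)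
    (hgW : ∀ y ∉ W, g y = 0) :
    ∃ (ρ : ℕ → Euc n → ℝ) (L : Set (Euc n)), IsCompact L ∧ L ⊆ P ∧ (∀ k, ContDiff ℝ 1 (ρ k)) ∧
      (∀ k, tsupport (ρ k) ⊆ L) ∧ (∀ k y, ‖ρ k y‖ ≤ M) ∧
      ∀ᵐ y, Tendsto (fun k => ρ k y) atTop (𝓝 (g y)) := by
  obtain ⟨δ, hδ, hδP⟩ := hW.exists_cthickening_subset_open isOpen_interior hWP
  have hgi : Integrable g := by
    have : IntegrableOn g W := Measure.integrableOn_of_bounded hW.measure_lt_top.ne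
      hg.aestronglyMeasurable (Eventually.of_forall fun y => hM y)
    exact (integrableOn_iff_integrable_of_support_subset fun y hy => by
      by_contra h; exact hy (hgW y h)).1 this
  refine ⟨fun k => (bumpSeq n δ hδ k).normed volume ⋆[ContinuousLinearMap.lsmul ℝ ℝ, volume] g,
    cthickening δ W, hW.cthickening, hδP.trans interior_subset, fun k => ?_, fun k => ?_,
    fun k y => ?_, ?_⟩
  · exact (bumpSeq n δ hδ k).hasCompactSupport_normed.contDiff_convolution_left (n := 1) _
      (bumpSeq n δ hδ k).contDiff_normed hgi.locallyIntegrable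
  · refine closure_minimal (fun y hy => ?_) isClosed_cthickening
    by_contra hyL
    refine hy (integral_eq_zero_of_ae (Eventually.of_forall fun t => ?_))
    by_cases ht : (bumpSeq n δ hδ k).normed volume t = 0
    · simp [ht]
    · have h1 : t ∈ Function.support ((bumpSeq n δ hδ k).normed volume) := ht
      rw [ContDiffBump.support_normed_eq, mem_ball_zero_iff] at h1
      have : g (y - t) = 0 := hgW _ fun hyt => hyL <|
        mem_cthickening_of_dist_le y (y - t) δ W hyt (by
          have e : y - (y - t) = t := by abel
          rw [dist_eq_norm, e]
          exact h1.le.trans (bumpSeq_rOut_le hδ k))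
      simp [this]
  · have h1 : Integrable fun t => (bumpSeq n δ hδ k).normed volume t * M :=
      (bumpSeq n δ hδ k).integrable_normed.mul_const M
    refine (norm_integral_le_of_norm_le h1 (Eventually.of_forall fun t => ?_)).trans ?_
    · have h2 := (bumpSeq n δ hδ k).nonneg_normed (μ := volume) t
      rw [ContinuousLinearMap.lsmul_apply, norm_smul, Real.norm_of_nonneg h2]
      exact mul_le_mul_of_nonneg_left (hM _) h2
    · rw [integral_mul_const, ContDiffBump.integral_normed, one_mul]
  · exact ContDiffBump.ae_convolution_tendsto_right_of_locallyIntegrable (K := 2)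
      (tendsto_bumpSeq_rOut hδ) (Eventually.of_forall fun k => (bumpSeq_rOut_eq hδ k).le)
      hgi.locallyIntegrable

lemma lintegral_enorm_mul_le_of_contDiff {n : ℕ} (hn : 2 ≤ n) {P : Set (Euc n)}
    {h : Euc n → ℝ≥0∞} (hh : Measurable h) {C : ℝ≥0∞} (hC : C ≠ ∞)
    (hP : ∀ ρ : Euc n → ℝ, ContDiff ℝ 1 ρ → HasCompactSupport ρ → tsupport ρ ⊆ P →
      ∫⁻ y, ‖ρ y‖ₑ * h y ≤ C * (∫⁻ y, ‖ρ y‖ₑ ^ (n : ℝ)) ^ (1 / (n : ℝ)))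
    {W : Set (Euc n)} (hW : IsCompact W)
    (hWP : W ⊆ interior P) {g : Euc n → ℝ} (hg : Measurable g) {M : ℝ} (hM : ∀ y, ‖g y‖ ≤ M)
    (hgW : ∀ y ∉ W, g y = 0) :
    ∫⁻ y, ‖g y‖ₑ * h y ≤ C * (∫⁻ y, ‖g y‖ₑ ^ (n : ℝ)) ^ (1 / (n : ℝ)) := by
  obtain ⟨ρ, L, hL, hLP, hρ, hρL, hρM, hρg⟩ := exists_contDiff_tendsto_ae hW hWP hg hM hgW
  have hn0 : (0 : ℝ) < n := by positivity
  have hlim : Tendsto (fun k => ∫⁻ y, ‖ρ k y‖ₑ ^ (n : ℝ)) atTop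
      (𝓝 (∫⁻ y, ‖g y‖ₑ ^ (n : ℝ))) := by
    refine tendsto_lintegral_of_dominated_convergence
      (L.indicator fun _ => ENNReal.ofReal M ^ (n : ℝ))
      (fun k => (hρ k).continuous.enorm.measurable.pow_const _) (fun k => ?_) ?_ ?_
    · refine Eventually.of_forall fun y => ?_
      beta_reduce
      by_cases hy : y ∈ L
      · rw [indicator_of_mem hy, ← ofReal_norm]
        gcongr
        exact hρM k y
      · rw [indicator_of_notMem hy, image_eq_zero_of_notMem_tsupport fun h => hy (hρL k h),
          enorm_zero, ENNReal.zero_rpow_of_pos hn0]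
    · rw [lintegral_indicator_const hL.measurableSet]
      exact ENNReal.mul_ne_top (ENNReal.rpow_ne_top_of_nonneg hn0.le ENNReal.ofReal_ne_top)
        hL.measure_lt_top.ne
    · filter_upwards [hρg] with y hy
      exact (ENNReal.continuous_rpow_const.tendsto _).comp hy.enorm
  have hlim' : Tendsto (fun k => C * (∫⁻ y, ‖ρ k y‖ₑ ^ (n : ℝ)) ^ (1 / (n : ℝ))) atTop
      (𝓝 (C * (∫⁻ y, ‖g y‖ₑ ^ (n : ℝ)) ^ (1 / (n : ℝ)))) :=
    ENNReal.Tendsto.const_mul ((ENNReal.continuous_rpow_const.tendsto _).comp hlim) (Or.inr hC)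
  calc ∫⁻ y, ‖g y‖ₑ * h y ≤ ∫⁻ y, liminf (fun k => ‖ρ k y‖ₑ * h y) atTop := by
        refine lintegral_mono_ae ?_
        filter_upwards [hρg] with y hy
        rcases eq_or_ne (g y) 0 with h0 | h0
        · simp [h0]
        · exact (ENNReal.Tendsto.mul_const hy.enorm (Or.inl (by simpa using h0))).liminf_eq.ge
    _ ≤ liminf (fun k => ∫⁻ y, ‖ρ k y‖ₑ * h y) atTop :=
      lintegral_liminf_le fun k => (hρ k).continuous.enorm.measurable.mul hh
    _ ≤ liminf (fun k => C * (∫⁻ y, ‖ρ k y‖ₑ ^ (n : ℝ)) ^ (1 / (n : ℝ))) atTop :=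
      liminf_le_liminf (Eventually.of_forall fun k => hP _ (hρ k)
        (hL.of_isClosed_subset (isClosed_tsupport _) (hρL k)) ((hρL k).trans hLP))
    _ = _ := hlim'.liminf_eq

lemma ENNReal.le_rpow_of_le_mul_rpow {X C : ℝ≥0∞} (hX : X ≠ ∞) {p s : ℝ} (hp : 0 < p)
    (hs : 0 < s) (hps : 1 / p + 1 / s = 1) (h : X ≤ C * X ^ (1 / p)) : X ≤ C ^ s := by
  rcases eq_or_ne X 0 with rfl | h0
  · exact zero_le
  have h1 : X = X ^ (1 / s) * X ^ (1 / p) := by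
    rw [← ENNReal.rpow_add _ _ h0 hX, add_comm, hps, ENNReal.rpow_one]
  have h2 : X ^ (1 / s) ≤ C := by
    rw [h1] at h
    refine (ENNReal.mul_le_mul_iff_left ?_ ?_).1 (h.trans_eq (by rw [← h1]))
    · exact (ENNReal.rpow_pos (pos_iff_ne_zero.2 h0) hX).ne'
    · exact ENNReal.rpow_ne_top_of_nonneg (by positivity) hX
  calc X = (X ^ (1 / s)) ^ s := by
        rw [← ENNReal.rpow_mul, one_div_mul_cancel hs.ne', ENNReal.rpow_one]
    _ ≤ C ^ s := by gcongr

lemma setLIntegral_rpow_le_of_contDiff {n : ℕ} (hn : 2 ≤ n) {P : Set (Euc n)}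
    {h : Euc n → ℝ≥0∞} (hh : Measurable h) {C : ℝ≥0∞} (hC : C ≠ ∞)
    (hP : ∀ ρ : Euc n → ℝ, ContDiff ℝ 1 ρ → HasCompactSupport ρ → tsupport ρ ⊆ P →
      ∫⁻ y, ‖ρ y‖ₑ * h y ≤ C * (∫⁻ y, ‖ρ y‖ₑ ^ (n : ℝ)) ^ (1 / (n : ℝ)))
    {W : Set (Euc n)} (hW : IsCompact W) (hWP : W ⊆ interior P) {s : ℝ} (hs : 1 < s)
    (hns : 1 / (n : ℝ) + 1 / s = 1) :
    ∫⁻ y in W, h y ^ s ≤ C ^ s := by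
  have hn0 : (0 : ℝ) < n := by positivity
  have hs0 : 0 < s := by linarith
  have hsn : (s - 1) * n = s := by
    field_simp at hns
    linarith
  have hbound : ∀ N : ℕ, ∫⁻ y in W, (min (h y) N) ^ s ≤ C ^ s := fun N => by
    set m : Euc n → ℝ≥0∞ := fun y => min (h y) N with hm
    have hmm : Measurable m := hh.min measurable_const
    have hmN : ∀ y, m y ≤ N := fun y => min_le_right _ _
    have hmt : ∀ y, m y ^ (s - 1) ≠ ∞ := fun y => ENNReal.rpow_ne_top_of_nonneg (by linarith)
      (ne_top_of_le_ne_top (ENNReal.natCast_ne_top N) (hmN y))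
    set g : Euc n → ℝ := W.indicator fun y => (m y ^ (s - 1)).toReal with hg
    have hgm : Measurable g := (hmm.pow_const _).ennreal_toReal.indicator hW.measurableSet
    have hge : ∀ y, ‖g y‖ₑ = W.indicator (fun y => m y ^ (s - 1)) y := fun y => by
      by_cases hy : y ∈ W
      · rw [hg, indicator_of_mem hy, indicator_of_mem hy, Real.enorm_of_nonneg ENNReal.toReal_nonneg,
          ENNReal.ofReal_toReal (hmt y)]
      · rw [hg, indicator_of_notMem hy, indicator_of_notMem hy, enorm_zero]
    have hgM : ∀ y, ‖g y‖ ≤ (((N : ℝ≥0∞)) ^ (s - 1)).toReal := fun y => by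
      rw [← toReal_enorm, hge]
      refine ENNReal.toReal_mono (ENNReal.rpow_ne_top_of_nonneg (by linarith)
        (ENNReal.natCast_ne_top N)) ((indicator_le_self _ _ _).trans ?_)
      exact ENNReal.rpow_le_rpow (hmN y) (by linarith)
    have key := lintegral_enorm_mul_le_of_contDiff hn hh hC hP hW hWP hgm hgM
      fun y hy => indicator_of_notMem hy _
    have e1 : ∫⁻ y, ‖g y‖ₑ ^ (n : ℝ) = ∫⁻ y in W, m y ^ s := by
      rw [← lintegral_indicator hW.measurableSet]
      refine lintegral_congr fun y => ?_
      rw [hge]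
      by_cases hy : y ∈ W
      · rw [indicator_of_mem hy, indicator_of_mem hy, ← ENNReal.rpow_mul, hsn]
      · rw [indicator_of_notMem hy, indicator_of_notMem hy, ENNReal.zero_rpow_of_pos hn0]
    have e2 : ∫⁻ y in W, m y ^ s ≤ ∫⁻ y, ‖g y‖ₑ * h y := by
      rw [← lintegral_indicator hW.measurableSet]
      refine lintegral_mono fun y => ?_
      rw [hge]
      by_cases hy : y ∈ W
      · rw [indicator_of_mem hy, indicator_of_mem hy]
        calc m y ^ s = m y ^ ((s - 1) + 1) := by rw [sub_add_cancel]
          _ = m y ^ (s - 1) * m y := by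
            rw [ENNReal.rpow_add_of_nonneg _ _ (by linarith) zero_le_one, ENNReal.rpow_one]
          _ ≤ _ := by gcongr; exact min_le_left _ _
      · rw [indicator_of_notMem hy]
        exact zero_le
    have hfin : ∫⁻ y in W, m y ^ s ≠ ∞ := by
      refine ne_top_of_le_ne_top (b := (N : ℝ≥0∞) ^ s * volume W) (ENNReal.mul_ne_top
        (ENNReal.rpow_ne_top_of_nonneg hs0.le (ENNReal.natCast_ne_top N))
        hW.measure_lt_top.ne) ?_
      rw [← setLIntegral_const]
      exact lintegral_mono fun y => ENNReal.rpow_le_rpow (hmN y) hs0.le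
    rw [e1] at key
    exact ENNReal.le_rpow_of_le_mul_rpow hfin hn0 hs0 hns (e2.trans key)
  have hsup : ∀ y, Tendsto (fun N : ℕ => (min (h y) N) ^ s) atTop (𝓝 (h y ^ s)) := fun y => by
    refine (ENNReal.continuous_rpow_const.tendsto _).comp ?_
    have := (tendsto_const_nhds (x := h y)).min ENNReal.tendsto_nat_nhds_top
    rwa [min_top_right] at this
  calc ∫⁻ y in W, h y ^ s = ∫⁻ y in W, liminf (fun N : ℕ => (min (h y) N) ^ s) atTop :=
        lintegral_congr fun y => (hsup y).liminf_eq.symm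
    _ ≤ liminf (fun N : ℕ => ∫⁻ y in W, (min (h y) N) ^ s) atTop :=
      lintegral_liminf_le fun N => (hh.min measurable_const).pow_const _
    _ ≤ C ^ s := by
      refine (liminf_le_liminf (Eventually.of_forall hbound)).trans ?_
      rw [liminf_const]

lemma measure_le_of_lintegral_contDiff_le {n : ℕ} (hn : 2 ≤ n) {P : Set (Euc n)}
    {ν : Measure (Euc n)} {C : ℝ≥0∞}
    (hP : ∀ ρ : Euc n → ℝ, ContDiff ℝ 1 ρ → HasCompactSupport ρ → tsupport ρ ⊆ P →
      ∫⁻ y, ‖ρ y‖ₑ ∂ν ≤ C * (∫⁻ y, ‖ρ y‖ₑ ^ (n : ℝ)) ^ (1 / (n : ℝ)))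
    {K U : Set (Euc n)} (hK : IsCompact K) (hU : IsOpen U) (hKU : K ⊆ U) (hUP : U ⊆ P) :
    ν K ≤ C * volume U ^ (1 / (n : ℝ)) := by
  have hn0 : (0 : ℝ) < n := by positivity
  obtain ⟨L, hL, hLc, hKL, hLU⟩ := exists_compact_closed_between hK hU hKU
  obtain ⟨f, hf1, hf0, hf⟩ := exists_contMDiffMap_one_nhds_of_subset_interior
    (modelWithCornersSelf ℝ (Euc n)) hK.isClosed hKL (n := 1)
  have hfL : tsupport f ⊆ L := closure_minimal (fun x hx => by
    by_contra h; exact hx (hf0 x h)) hLc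
  have hle : ∀ y, ‖f y‖ₑ ≤ 1 := fun y => by
    rw [Real.enorm_of_nonneg (hf y).1]
    exact ENNReal.ofReal_le_one.2 (hf y).2
  calc ν K = ∫⁻ y in K, 1 ∂ν := by simp
    _ ≤ ∫⁻ y in K, ‖f y‖ₑ ∂ν := by
        refine setLIntegral_mono' hK.measurableSet fun y hy => ?_
        rw [hf1.self_of_nhdsSet y hy]
        simp
    _ ≤ ∫⁻ y, ‖f y‖ₑ ∂ν := setLIntegral_le_lintegral _ _
    _ ≤ C * (∫⁻ y, ‖f y‖ₑ ^ (n : ℝ)) ^ (1 / (n : ℝ)) :=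
      hP _ f.contMDiff.contDiff (hL.of_isClosed_subset (isClosed_tsupport _) hfL)
        (hfL.trans (hLU.trans hUP))
    _ ≤ C * (∫⁻ y, U.indicator 1 y) ^ (1 / (n : ℝ)) := by
        gcongr with y
        by_cases hy : y ∈ U
        · rw [indicator_of_mem hy]
          exact ENNReal.rpow_le_one (hle y) hn0.le
        · rw [hf0 y fun h => hy (hLU h), enorm_zero, ENNReal.zero_rpow_of_pos hn0]
          exact zero_le
    _ = _ := by rw [lintegral_indicator_one hU.measurableSet]

lemma restrict_absolutelyContinuous_of_lintegral_contDiff_le {n : ℕ} (hn : 2 ≤ n) {P : Set (Euc n)}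
    {ν : Measure (Euc n)} [IsFiniteMeasure ν] {C : ℝ≥0∞} (hC : C ≠ ∞)
    (hP : ∀ ρ : Euc n → ℝ, ContDiff ℝ 1 ρ → HasCompactSupport ρ → tsupport ρ ⊆ P →
      ∫⁻ y, ‖ρ y‖ₑ ∂ν ≤ C * (∫⁻ y, ‖ρ y‖ₑ ^ (n : ℝ)) ^ (1 / (n : ℝ))) :
    ν.restrict (interior P) ≪ volume := by
  have hn0 : (0 : ℝ) < n := by positivity
  have hUle : ∀ U : Set (Euc n), IsOpen U → U ⊆ P → ν U ≤ C * volume U ^ (1 / (n : ℝ)) :=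
    fun U hU hUP => by
      rw [hU.measure_eq_iSup_isCompact]
      exact iSup₂_le fun K hKU => iSup_le fun hK =>
        measure_le_of_lintegral_contDiff_le hn hP hK hU hKU hUP
  refine Measure.AbsolutelyContinuous.mk fun A hA h0 => ?_
  rw [Measure.restrict_apply hA]
  have hlim : Tendsto (fun ε : ℝ≥0∞ => C * ε ^ (1 / (n : ℝ))) (𝓝[>] 0) (𝓝 0) := by
    have h1 : Tendsto (fun ε : ℝ≥0∞ => C * ε ^ (1 / (n : ℝ))) (𝓝 0)
        (𝓝 (C * 0 ^ (1 / (n : ℝ)))) :=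
      ENNReal.Tendsto.const_mul (ENNReal.continuous_rpow_const.tendsto 0) (Or.inr hC)
    rw [ENNReal.zero_rpow_of_pos (by positivity), mul_zero] at h1
    exact h1.mono_left nhdsWithin_le_nhds
  refine le_antisymm (ge_of_tendsto hlim (eventually_mem_nhdsWithin.mono fun ε hε => ?_)) zero_le
  obtain ⟨U, hAU, hU, hUε⟩ := A.exists_isOpen_lt_of_lt ε (by rw [h0]; exact hε)
  calc ν (A ∩ interior P) ≤ ν (U ∩ interior P) := by gcongr
    _ ≤ C * volume (U ∩ interior P) ^ (1 / (n : ℝ)) :=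
      hUle _ (hU.inter isOpen_interior) (inter_subset_right.trans interior_subset)
    _ ≤ C * ε ^ (1 / (n : ℝ)) := by
        gcongr
        exact (measure_mono inter_subset_left).trans hUε.le

lemma exists_density_of_lintegral_contDiff_le {n : ℕ} (hn : 2 ≤ n) {P : Set (Euc n)}
    {ν : Measure (Euc n)} [IsFiniteMeasure ν] {C : ℝ≥0∞} (hC : C ≠ ∞)
    (hP : ∀ ρ : Euc n → ℝ, ContDiff ℝ 1 ρ → HasCompactSupport ρ → tsupport ρ ⊆ P →
      ∫⁻ y, ‖ρ y‖ₑ ∂ν ≤ C * (∫⁻ y, ‖ρ y‖ₑ ^ (n : ℝ)) ^ (1 / (n : ℝ)))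
    {s : ℝ} (hs : 1 < s) (hns : 1 / (n : ℝ) + 1 / s = 1) :
    ∃ h : Euc n → ℝ≥0∞, Measurable h ∧
      (∀ B, MeasurableSet B → B ⊆ interior P → ν B = ∫⁻ y in B, h y) ∧
      ∀ W, IsCompact W → W ⊆ interior P → ∫⁻ y in W, h y ^ s ≠ ∞ := by
  have hac := restrict_absolutelyContinuous_of_lintegral_contDiff_le hn hC hP
  have hmeas := Measure.measurable_rnDeriv (ν.restrict (interior P)) volume
  have heq := Measure.withDensity_rnDeriv_eq _ _ hac
  refine ⟨(ν.restrict (interior P)).rnDeriv volume, hmeas, fun B hB hBP => ?_, fun W hW hWP => ?_⟩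
  · rw [← withDensity_apply _ hB, heq, Measure.restrict_apply hB, inter_eq_self_of_subset_left hBP]
  · refine ne_top_of_le_ne_top (ENNReal.rpow_ne_top_of_nonneg (by linarith) hC)
      (setLIntegral_rpow_le_of_contDiff hn hmeas hC (fun ρ hρ hρc hρP => ?_) hW hWP hs hns)
    refine le_trans ?_ (hP ρ hρ hρc hρP)
    calc _ = ∫⁻ y, ‖ρ y‖ₑ ∂(ν.restrict (interior P)) := by
          nth_rw 2 [← heq]
          rw [lintegral_withDensity_eq_lintegral_mul _ hmeas hρ.continuous.enorm.measurable]
          exact lintegral_congr fun y => mul_comm _ _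
      _ ≤ _ := setLIntegral_le_lintegral _ _

lemma IsCompOpBddWith.exists_density {n : ℕ} (hn : 2 ≤ n) {Ω Ω' : Set (Euc n)}
    (hΩ : IsOpen Ω) {φ : Euc n → Euc n} (hφ : IsHomeoOn φ Ω Ω') {q : ℝ} (hq : 1 ≤ q)
    {K : ℝ≥0∞} (hK : K ≠ ∞) (h : IsCompOpBddWith Ω Ω' φ (n : ℝ≥0∞) (ENNReal.ofReal q) K)
    {D : Euc n → Euc n →L[ℝ] Euc n} (hD : HasWeakDerivOn φ D Ω) {P : Set (Euc n)}
    (hP : IsCompact P) (hPΩ : P ⊆ Ω') {s : ℝ} (hs : 1 < s) (hns : 1 / (n : ℝ) + 1 / s = 1) :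
    ∃ h : Euc n → ℝ≥0∞, Measurable h ∧
      (∀ B, MeasurableSet B → B ⊆ interior P →
        ∫⁻ x in Ω ∩ φ ⁻¹' B, ‖D x‖ₑ = ∫⁻ y in B, h y) ∧
      ∀ W, IsCompact W → W ⊆ interior P → ∫⁻ y in W, h y ^ s ≠ ∞ := by
  obtain ⟨C, hC, hCP⟩ := h.exists_lintegral_fderiv_comp_le hn hΩ hφ hq hK hD hP hPΩ
  have hφm := hφ.2.1.aestronglyMeasurable (μ := volume) hΩ.measurableSet
  have hDm := hD.2.1.aestronglyMeasurable
  have hQ := hφ.isCompact_inter_preimage hP hPΩ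
  set Q := Ω ∩ φ ⁻¹' P with hQdef
  have hDQ : IntegrableOn D Q := hD.2.1.integrableOn_compact_subset inter_subset_left hQ
  set μ : Measure (Euc n) := (volume.restrict Q).withDensity fun x => ‖D x‖ₑ with hμ
  have hμfin : IsFiniteMeasure μ := isFiniteMeasure_withDensity hDQ.2.ne
  have hφμ : AEMeasurable φ μ := (hφm.aemeasurable.mono_set inter_subset_left).mono_ac
    (withDensity_absolutelyContinuous _ _)
  obtain ⟨d, hd, hdB, hdW⟩ := exists_density_of_lintegral_contDiff_le (P := P) (ν := μ.map φ) hn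
    (C := 2 * n * C) (ENNReal.mul_ne_top (by finiteness) hC) (fun ρ hρ hρc hρP => by
      refine le_trans ?_ (lintegral_enorm_mul_enorm_deriv_le hn hφm hDm hC hCP hρ hρc hρP)
      have hρm := hρ.continuous.enorm.measurable
      have e1 : ∫⁻ x, ‖ρ (φ x)‖ₑ ∂μ = ∫⁻ x in Q, ‖D x‖ₑ * ‖ρ (φ x)‖ₑ :=
        lintegral_withDensity_eq_lintegral_mul₀' (hDm.enorm.mono_set inter_subset_left)
          (hρm.comp_aemeasurable hφμ)
      rw [lintegral_map' hρm.aemeasurable hφμ, e1]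
      refine (lintegral_mono_set inter_subset_left).trans_eq (lintegral_congr fun x => ?_)
      exact mul_comm _ _) hs hns
  refine ⟨d, hd, fun B hB hBP => ?_, hdW⟩
  rw [← hdB B hB hBP, Measure.map_apply_of_aemeasurable hφμ hB, hμ, withDensity_apply',
    Measure.restrict_restrict' hQ.measurableSet, hQdef]
  congr 2
  ext x
  exact ⟨fun hx => ⟨hx.2, hx.1, interior_subset (s := P) (hBP hx.2)⟩, fun hx => ⟨hx.2.1, hx.1⟩⟩

lemma eLpNorm_le_lintegral_weakDeriv {n : ℕ} {v : Euc n → Euc n} {G : Euc n → Euc n →L[ℝ] Euc n}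
    {Ω K : Set (Euc n)} (hΩ : IsOpen Ω) (h : HasWeakDerivOn v G Ω) (hv : Continuous v)
    (hK : IsCompact K) (hKΩ : K ⊆ Ω) (hvK : ∀ x ∉ K, v x = 0) {p : NNReal}
    (hp : NNReal.HolderConjugate (Module.finrank ℝ (Euc n)) p) :
    eLpNorm v p volume ≤
      eLpNormLESNormFDerivOneConst (volume : Measure (Euc n)) p * ∫⁻ x in Ω, ‖G x‖ₑ := by
  obtain ⟨δ, hδ, hδΩ⟩ := hK.exists_cthickening_subset_open hΩ hKΩ
  have hδ2 : 0 < δ / 2 := by positivity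
  have hvi := hv.locallyIntegrable (μ := (volume : Measure (Euc n)))
  have hsupp : ∀ k, tsupport (mollify (bumpSeq n _ hδ2 k) v) ⊆ cthickening (δ / 2) K := fun k => by
    refine closure_minimal (fun y hy => ?_) isClosed_cthickening
    by_contra hyL
    refine hy (integral_eq_zero_of_ae (Eventually.of_forall fun t => ?_))
    by_cases ht : (bumpSeq n _ hδ2 k).normed volume t = 0
    · simp [ht]
    · have h1 : t ∈ Function.support ((bumpSeq n _ hδ2 k).normed volume) := ht
      rw [ContDiffBump.support_normed_eq, mem_ball_zero_iff] at h1
      have : v (y - t) = 0 := hvK _ fun hyt => hyL <|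
        mem_cthickening_of_dist_le y (y - t) _ K hyt (by
          have e : y - (y - t) = t := by abel
          rw [dist_eq_norm, e]
          exact h1.le.trans (bumpSeq_rOut_le hδ2 k))
      simp [this]
  have hpt : ∀ k a, ‖fderiv ℝ (mollify (bumpSeq n _ hδ2 k) v) a‖ₑ ≤
      ∫⁻ z in Ω, ENNReal.ofReal ((bumpSeq n _ hδ2 k).normed volume (a - z)) * ‖G z‖ₑ := fun k a => by
    by_cases ha : a ∈ cthickening (δ / 2) K
    · refine enorm_fderiv_mollify_le _ hvi hΩ.measurableSet h.2.2 ?_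
      refine Subset.trans ?_ hδΩ
      calc closedBall a (bumpSeq n _ hδ2 k).rOut ⊆ closedBall a (δ / 2) :=
            closedBall_subset_closedBall (bumpSeq_rOut_le hδ2 k)
        _ ⊆ cthickening (δ / 2) (cthickening (δ / 2) K) := closedBall_subset_cthickening ha _
        _ ⊆ cthickening (δ / 2 + δ / 2) K := cthickening_cthickening_subset hδ2.le hδ2.le K
        _ = cthickening δ K := by rw [add_halves]
    · have : fderiv ℝ (mollify (bumpSeq n _ hδ2 k) v) a = 0 :=
        image_eq_zero_of_notMem_tsupport fun h =>
          ha (hsupp k (tsupport_fderiv_subset ℝ h))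
      rw [this, ← ofReal_norm, norm_zero, ENNReal.ofReal_zero]
      exact zero_le
  have h_int : ∀ k, ∫⁻ a, ‖fderiv ℝ (mollify (bumpSeq n _ hδ2 k) v) a‖ₑ ≤ ∫⁻ z in Ω, ‖G z‖ₑ :=
    fun k => by
    set β := bumpSeq n _ hδ2 k
    have hone : ∀ z, ∫⁻ a, ENNReal.ofReal (β.normed volume (a - z)) = 1 := fun z => by
      rw [lintegral_sub_right_eq_self (fun a => ENNReal.ofReal (β.normed volume a)) z,
        ← ofReal_integral_eq_lintegral_ofReal β.integrable_normed
          (Eventually.of_forall β.nonneg_normed), β.integral_normed, ENNReal.ofReal_one]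
    calc _ ≤ ∫⁻ a, ∫⁻ z in Ω, ENNReal.ofReal (β.normed volume (a - z)) * ‖G z‖ₑ :=
          lintegral_mono (hpt k)
      _ = ∫⁻ z in Ω, ∫⁻ a, ENNReal.ofReal (β.normed volume (a - z)) * ‖G z‖ₑ := by
          refine lintegral_lintegral_swap (AEMeasurable.mul ?_
            h.2.1.aestronglyMeasurable.enorm.comp_snd)
          exact (ENNReal.continuous_ofReal.comp
            (β.continuous_normed.comp (continuous_fst.sub continuous_snd))).measurable.aemeasurable
      _ = _ := by
          refine lintegral_congr fun z => ?_
          rw [lintegral_mul_const' _ _ enorm_ne_top, hone, one_mul]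
  refine (Lp.eLpNorm_lim_le_liminf_eLpNorm (f := fun k => mollify (bumpSeq n _ hδ2 k) v)
    (fun k => (mollify_contDiff _ hvi).continuous.aestronglyMeasurable) v
    (Eventually.of_forall fun x => tendsto_mollify hδ2 hvi.aestronglyMeasurable
      hv.continuousAt)).trans ?_
  refine liminf_le_of_le (by isBoundedDefault) fun b hb => ?_
  obtain ⟨k, hk⟩ := hb.exists
  refine hk.trans ((eLpNorm_le_eLpNorm_fderiv_one volume (mollify_contDiff _ hvi)
    (hK.cthickening.of_isClosed_subset (isClosed_tsupport _) (hsupp k)) hp).trans ?_)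
  rw [eLpNorm_one_eq_lintegral_enorm]
  exact mul_le_mul' le_rfl (h_int k)

lemma exists_scaled_bump (n : ℕ) : ∃ M : ℝ, ∀ (y : Euc n) (r : ℝ), 0 < r →
    ∃ f : Euc n → ℝ, ContDiff ℝ 1 f ∧ tsupport f ⊆ closedBall y (2 * r) ∧
      (∀ z ∈ ball y r, f z = 1) ∧ ∀ z, ‖fderiv ℝ f z‖ ≤ M / r := by
  obtain ⟨b, hb, hb1, hb2⟩ : ∃ b : Euc n → ℝ, ContDiff ℝ 1 b ∧
      (∀ z, ‖z‖ ≤ 1 → b z = 1) ∧ ∀ z, b z ≠ 0 → ‖z‖ < 2 := by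
    obtain ⟨β, h1, h2⟩ : ∃ β : ContDiffBump (0 : Euc n), β.rIn = 1 ∧ β.rOut = 2 :=
      ⟨⟨1, 2, one_pos, one_lt_two⟩, rfl, rfl⟩
    refine ⟨β, β.contDiff, fun z hz => β.one_of_mem_closedBall ?_, fun z hz => ?_⟩
    · rw [mem_closedBall_zero_iff, h1]
      exact hz
    · have : z ∈ Function.support β := hz
      rwa [β.support_eq, mem_ball_zero_iff, h2] at this
  have hbc : HasCompactSupport b := HasCompactSupport.of_support_subset_isCompact
    (isCompact_closedBall (0 : Euc n) 2) fun z hz => mem_closedBall_zero_iff.2 (hb2 z hz).le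
  obtain ⟨M, hM⟩ := (hb.continuous_fderiv one_ne_zero).bounded_above_of_compact_support
    (hbc.fderiv ℝ)
  refine ⟨M, fun y r hr => ⟨fun z => b (r⁻¹ • (z - y)), ?_, ?_, fun z hz => ?_, fun z => ?_⟩⟩
  · exact hb.comp (by fun_prop)
  · refine closure_minimal (fun z hz => ?_) isClosed_closedBall
    have := hb2 _ hz
    rw [norm_smul, norm_inv, Real.norm_of_nonneg hr.le, inv_mul_lt_iff₀ hr] at this
    rw [mem_closedBall, dist_eq_norm]
    linarith
  · refine hb1 _ ?_
    rw [norm_smul, norm_inv, Real.norm_of_nonneg hr.le, inv_mul_le_iff₀ hr, mul_one,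
      ← dist_eq_norm]
    exact (mem_ball.1 hz).le
  · have h1 : HasFDerivAt (fun z : Euc n => r⁻¹ • (z - y))
        (r⁻¹ • ContinuousLinearMap.id ℝ (Euc n)) z :=
      ((hasFDerivAt_id z).sub_const y).const_smul r⁻¹
    have h2 := ((hb.differentiable one_ne_zero (r⁻¹ • (z - y))).hasFDerivAt).comp z h1
    have h3 : fderiv ℝ (fun z => b (r⁻¹ • (z - y))) z = _ := h2.fderiv
    rw [h3, ContinuousLinearMap.comp_smul, ContinuousLinearMap.comp_id, norm_smul, norm_inv,
      Real.norm_of_nonneg hr.le, div_eq_inv_mul]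
    gcongr
    exact hM _

lemma IsCompOpBddWith.exists_volume_preimage_ball_le {n : ℕ} (hn : 2 ≤ n) {Ω Ω' : Set (Euc n)}
    (hΩ : IsOpen Ω) {φ : Euc n → Euc n} (hφ : IsHomeoOn φ Ω Ω') {q : ℝ} (hq : 1 ≤ q)
    {K : ℝ≥0∞} (h : IsCompOpBddWith Ω Ω' φ (n : ℝ≥0∞) (ENNReal.ofReal q) K)
    {D : Euc n → Euc n →L[ℝ] Euc n} (hD : HasWeakDerivOn φ D Ω)
    {s : ℝ} (hs : 1 < s) (hns : 1 / (n : ℝ) + 1 / s = 1) :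
    ∃ C : ℝ≥0∞, C ≠ ∞ ∧ ∀ (y : Euc n) (r : ℝ), 0 < r → closedBall y (2 * r) ⊆ Ω' →
      volume (Ω ∩ φ ⁻¹' ball y r) ≤
        C * (ENNReal.ofReal r⁻¹ * ∫⁻ x in Ω ∩ φ ⁻¹' closedBall y (2 * r), ‖D x‖ₑ) ^ s := by
  have hs0 : 0 < s := by linarith
  obtain ⟨M, hM⟩ := exists_scaled_bump n
  obtain ⟨e, he⟩ : ∃ e : Euc n, ‖e‖ = 1 :=
    ⟨_, (EuclideanSpace.basisFun (Fin n) ℝ).norm_eq_one ⟨0, by omega⟩⟩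
  have hp : NNReal.HolderConjugate (Module.finrank ℝ (Euc n)) s.toNNReal := by
    rw [finrank_euclideanSpace, Fintype.card_fin]
    refine NNReal.holderConjugate_coe_iff.1 (Real.holderConjugate_iff.2 ⟨?_, ?_⟩)
    · simp only [NNReal.coe_natCast, Nat.one_lt_cast]
      omega
    · rw [Real.coe_toNNReal _ hs0.le]
      simpa using hns
  set A := eLpNormLESNormFDerivOneConst (volume : Measure (Euc n)) s.toNNReal
  refine ⟨((A : ℝ≥0∞) * ENNReal.ofReal M) ^ s, ENNReal.rpow_ne_top_of_nonneg hs0.le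
    (by finiteness), fun y r hr hyΩ => ?_⟩
  obtain ⟨f, hf, hfs, hf1, hfM⟩ := hM y r hr
  have hQ := hφ.isCompact_inter_preimage (isCompact_closedBall y (2 * r)) hyΩ
  have hc : HasCompactSupport f :=
    (isCompact_closedBall y (2 * r)).of_isClosed_subset (isClosed_tsupport f) hfs
  obtain ⟨g, hg, -⟩ := h.exists_weakGradient hn hq hf hc
  have hae := hg.ae_enorm_comp_eq hn hΩ hφ.2.1 hD hf
  set v : Euc n → Euc n := Ω.indicator fun x => f (φ x) • e with hv
  have hv0 : ∀ x ∉ Ω ∩ φ ⁻¹' closedBall y (2 * r), v x = 0 := fun x hx => by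
    by_cases hxΩ : x ∈ Ω
    · rw [hv, indicator_of_mem hxΩ,
        image_eq_zero_of_notMem_tsupport fun hx' => hx ⟨hxΩ, hfs hx'⟩, zero_smul]
    · rw [hv, indicator_of_notMem hxΩ]
  have hvc : Continuous v := continuous_iff_continuousAt.2 fun x => by
    by_cases hxΩ : x ∈ Ω
    · have h1 : ContinuousAt (fun x => f (φ x) • e) x :=
        (hf.continuous.continuousAt.comp (hφ.2.1.continuousAt (hΩ.mem_nhds hxΩ))).smul
          continuousAt_const
      refine h1.congr ?_
      filter_upwards [hΩ.mem_nhds hxΩ] with z hz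
      rw [hv, indicator_of_mem hz]
    · refine (continuousAt_const (y := (0 : Euc n))).congr ?_
      filter_upwards [hQ.isClosed.isOpen_compl.mem_nhds fun hx => hxΩ hx.1] with z hz
      exact (hv0 z hz).symm
  have hvD : HasWeakDerivOn v (fun x => (innerSL ℝ (g x)).smulRight e) Ω :=
    (hg.smul_const e).congr hΩ (fun x hx => by rw [hv, indicator_of_mem hx]; rfl)
      (Eventually.of_forall fun _ => rfl)
  have hsob := eLpNorm_le_lintegral_weakDeriv hΩ hvD hvc hQ inter_subset_left hv0 hp
  have hG : ∫⁻ x in Ω, ‖(innerSL ℝ (g x)).smulRight e‖ₑ ≤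
      ENNReal.ofReal (M / r) * ∫⁻ x in Ω ∩ φ ⁻¹' closedBall y (2 * r), ‖D x‖ₑ := by
    calc _ = ∫⁻ x in Ω, ‖(fderiv ℝ f (φ x)).comp (D x)‖ₑ := by
          refine lintegral_congr_ae (hae.mono fun x hx => ?_)
          beta_reduce
          rw [← hx, ← ofReal_norm, ← ofReal_norm, ContinuousLinearMap.norm_smulRight_apply, he,
            mul_one, innerSL_apply_norm]
      _ = ∫⁻ x in Ω ∩ φ ⁻¹' closedBall y (2 * r), ‖(fderiv ℝ f (φ x)).comp (D x)‖ₑ :=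
          lintegral_fderiv_comp_eq_of_tsupport hfs D hQ.measurableSet hΩ.measurableSet
      _ ≤ ∫⁻ x in Ω ∩ φ ⁻¹' closedBall y (2 * r), ENNReal.ofReal (M / r) * ‖D x‖ₑ := by
          refine lintegral_mono fun x => ?_
          rw [← ofReal_norm, ← ofReal_norm, ← ENNReal.ofReal_mul' (norm_nonneg _)]
          refine ENNReal.ofReal_le_ofReal ((ContinuousLinearMap.opNorm_comp_le _ _).trans ?_)
          gcongr
          exact hfM _
      _ = _ := lintegral_const_mul' _ _ ENNReal.ofReal_ne_top
  have hset : MeasurableSet (Ω ∩ φ ⁻¹' ball y r) :=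
    (hφ.2.1.isOpen_inter_preimage hΩ isOpen_ball).measurableSet
  calc volume (Ω ∩ φ ⁻¹' ball y r) = ∫⁻ x in Ω ∩ φ ⁻¹' ball y r, 1 := by simp
    _ ≤ ∫⁻ x in Ω ∩ φ ⁻¹' ball y r, ‖v x‖ₑ ^ s := by
        refine setLIntegral_mono' hset fun x hx => ?_
        rw [hv, indicator_of_mem hx.1, hf1 _ hx.2, one_smul, ← ofReal_norm, he]
        simp
    _ ≤ ∫⁻ x, ‖v x‖ₑ ^ s := setLIntegral_le_lintegral _ _
    _ = eLpNorm v s.toNNReal volume ^ s := by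
        have := eLpNorm_nnreal_pow_eq_lintegral (f := v) (μ := volume)
          (p := s.toNNReal) (Real.toNNReal_pos.2 hs0).ne'
        rw [Real.coe_toNNReal _ hs0.le] at this
        rw [this]
    _ ≤ (A * (ENNReal.ofReal (M / r) *
        ∫⁻ x in Ω ∩ φ ⁻¹' closedBall y (2 * r), ‖D x‖ₑ)) ^ s := by
        gcongr
        exact hsob.trans (mul_le_mul' le_rfl hG)
    _ = _ := by
        rw [div_eq_mul_inv, ENNReal.ofReal_mul' (inv_nonneg.2 hr.le),
          ← ENNReal.mul_rpow_of_nonneg _ _ hs0.le]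
        ring_nf

lemma measure_eq_zero_of_ball_le {n : ℕ} {μ τ : Measure (Euc n)} [SFinite μ] [IsFiniteMeasure τ]
    {K : Set (Euc n)} (hK : IsCompact K) {C : ℝ≥0∞} (hC : C ≠ ∞) {r₀ : ℝ} (hr₀ : 0 < r₀)
    (h : ∀ y ∈ thickening r₀ K, ∀ r ∈ Ioo 0 r₀, μ (ball y r) ≤ C * τ (closedBall y (2 * r)))
    (hτ : τ K = 0) : μ K = 0 := by
  set B : ℝ → ℝ≥0∞ := fun r => volume (ball (0 : Euc n) r) with hB
  have hvol : ∀ x r, volume (ball (x : Euc n) r) = B r := fun x r =>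
    Measure.addHaar_ball_center _ _ _
  have hmain : ∀ r ∈ Ioo 0 r₀, μ K ≤ C * 2 ^ n * τ (cthickening (3 * r) K) := fun r hr => by
    have hr0 : 0 < r := hr.1
    have hBr : B r ≠ 0 := (measure_ball_pos _ _ hr0).ne'
    have hBt : B r ≠ ∞ := measure_ball_lt_top.ne
    have hS : MeasurableSet {p : Euc n × Euc n | dist p.2 p.1 < r} :=
      (isOpen_lt (continuous_snd.dist continuous_fst) continuous_const).measurableSet
    have hT : MeasurableSet {p : Euc n × Euc n | dist p.2 p.1 ≤ 2 * r} :=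
      (isClosed_le (continuous_snd.dist continuous_fst) continuous_const).measurableSet
    have e1 : μ K * B r = ∫⁻ y, μ.restrict K (ball y r) := by
      have h1 := Measure.prod_apply (μ := volume) (ν := μ.restrict K) hS
      have h2 := Measure.prod_apply_symm (μ := volume) (ν := μ.restrict K) hS
      rw [h1] at h2
      refine Eq.trans ?_ h2.symm
      calc μ K * B r = ∫⁻ x in K, B r ∂μ := by rw [setLIntegral_const, mul_comm]
        _ = _ := lintegral_congr fun x => by
            rw [← hvol x r]
            congr 1
            ext y
            simp [dist_comm]
    have e2 : ∫⁻ y in thickening r K, τ (closedBall y (2 * r)) ≤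
        B (2 * r) * τ (cthickening (3 * r) K) := by
      have h1 := Measure.prod_apply (μ := volume.restrict (thickening r K)) (ν := τ) hT
      have h2 := Measure.prod_apply_symm (μ := volume.restrict (thickening r K)) (ν := τ) hT
      rw [h1] at h2
      refine (h2.trans_le ?_)
      rw [← setLIntegral_const, ← lintegral_indicator isClosed_cthickening.measurableSet]
      refine lintegral_mono fun z => ?_
      by_cases hz : z ∈ cthickening (3 * r) K
      · rw [indicator_of_mem hz]
        refine (Measure.restrict_apply_le _ _).trans ?_
        have e : volume (closedBall z (2 * r)) = B (2 * r) :=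
          (Measure.addHaar_closedBall volume z (by positivity)).trans
            (Measure.addHaar_ball_of_pos volume _ (by positivity)).symm
        rw [← e]
        refine measure_mono fun y hy => ?_
        rw [mem_closedBall, dist_comm]
        exact hy
      · rw [indicator_of_notMem hz, Measure.restrict_apply (hT.preimage (by fun_prop))]
        refine (measure_mono_null (fun y hy => ?_) measure_empty).le
        obtain ⟨hy1, hy2⟩ := hy
        obtain ⟨x, hx, hxy⟩ := mem_thickening_iff.1 hy2
        have hy1' : dist z y ≤ 2 * r := hy1
        exact hz (mem_cthickening_of_dist_le z x _ K hx (by linarith [dist_triangle z y x]))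
    have e3 : ∫⁻ y, μ.restrict K (ball y r) ≤
        C * ∫⁻ y in thickening r K, τ (closedBall y (2 * r)) := by
      rw [← lintegral_const_mul' _ _ hC, ← lintegral_indicator isOpen_thickening.measurableSet]
      refine lintegral_mono fun y => ?_
      by_cases hy : y ∈ thickening r K
      · rw [indicator_of_mem hy]
        exact (Measure.restrict_apply_le _ _).trans (h y (thickening_mono hr.2.le K hy) r hr)
      · rw [indicator_of_notMem hy, Measure.restrict_apply measurableSet_ball]
        refine (measure_mono_null (fun x hx => ?_) measure_empty).le
        exact hy (mem_thickening_iff.2 ⟨x, hx.2, by rw [dist_comm]; exact hx.1⟩)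
    have e4 : B (2 * r) = 2 ^ n * B r := volume_ball_two_mul _ _ _
    have h5 : μ K * B r ≤ (C * 2 ^ n * τ (cthickening (3 * r) K)) * B r := by
      rw [e1]
      refine e3.trans ((mul_le_mul' le_rfl e2).trans_eq ?_)
      rw [e4]
      ring
    exact (ENNReal.mul_le_mul_iff_left hBr hBt).1 h5
  have hlim : Tendsto (fun r : ℝ => C * 2 ^ n * τ (cthickening (3 * r) K)) (𝓝[>] 0)
      (𝓝 (C * 2 ^ n * τ K)) := by
    refine ENNReal.Tendsto.const_mul ?_ (Or.inr (ENNReal.mul_ne_top hC (by finiteness)))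
    refine (tendsto_measure_cthickening_of_isCompact hK).comp ?_
    have : Tendsto (fun r : ℝ => 3 * r) (𝓝 0) (𝓝 (3 * 0)) := tendsto_id.const_mul 3
    rw [mul_zero] at this
    exact this.mono_left nhdsWithin_le_nhds
  rw [hτ, mul_zero] at hlim
  exact le_antisymm (ge_of_tendsto hlim (eventually_of_mem (Ioo_mem_nhdsGT hr₀) hmain)) zero_le

lemma rpow_inv_mul_lintegral_closedBall_le {n : ℕ} (hn : 2 ≤ n) {h : Euc n → ℝ≥0∞}
    (hh : Measurable h) {s : ℝ} (hs : 1 < s) (hns : 1 / (n : ℝ) + 1 / s = 1) (y : Euc n) {r : ℝ}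
    (hr : 0 < r) :
    (ENNReal.ofReal r⁻¹ * ∫⁻ z in closedBall y (2 * r), h z) ^ s ≤
      (2 * volume (ball (0 : Euc n) 1) ^ (1 / (n : ℝ))) ^ s *
        ∫⁻ z in closedBall y (2 * r), h z ^ s := by
  have hs0 : 0 < s := by linarith
  have hn0 : (0 : ℝ) < n := by positivity
  have hpq : s.HolderConjugate n := Real.holderConjugate_iff.2 ⟨hs, by
    rw [add_comm]; simpa using hns⟩
  have h1 := ENNReal.lintegral_mul_le_Lp_mul_Lq (volume.restrict (closedBall y (2 * r))) hpq
    hh.aemeasurable (g := fun _ => 1) aemeasurable_const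
  have h2 : ∫⁻ z in closedBall y (2 * r), (h * fun _ : Euc n => (1 : ℝ≥0∞)) z = ∫⁻ z in closedBall y (2 * r), h z :=
    lintegral_congr fun z => mul_one _
  simp only [ENNReal.one_rpow, setLIntegral_const, one_mul] at h1
  rw [h2, Measure.addHaar_closedBall volume _ (by positivity : 0 ≤ 2 * r), finrank_euclideanSpace,
    Fintype.card_fin, ENNReal.mul_rpow_of_nonneg _ _ (by positivity),
    ENNReal.ofReal_pow (by positivity), ← ENNReal.rpow_natCast, ← ENNReal.rpow_mul,
    mul_one_div_cancel hn0.ne', ENNReal.rpow_one] at h1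
  set I := ∫⁻ z in closedBall y (2 * r), h z ^ s
  set V := volume (ball (0 : Euc n) 1) ^ (1 / (n : ℝ))
  have e : ENNReal.ofReal r⁻¹ * ENNReal.ofReal (2 * r) = 2 := by
    rw [← ENNReal.ofReal_mul (by positivity)]
    field_simp
    simp
  calc _ ≤ (ENNReal.ofReal r⁻¹ * (I ^ (1 / s) * (ENNReal.ofReal (2 * r) * V))) ^ s := by
        gcongr
    _ = ((2 * V) * I ^ (1 / s)) ^ s := by
        rw [← e]
        ring_nf
    _ = _ := by
        rw [ENNReal.mul_rpow_of_nonneg _ _ hs0.le, ← ENNReal.rpow_mul, one_div_mul_cancel hs0.ne',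
          ENNReal.rpow_one]

lemma IsHomeoOn.measurableSet_inter_preimage {n : ℕ} {Ω Ω' : Set (Euc n)} {φ : Euc n → Euc n}
    (hφ : IsHomeoOn φ Ω Ω') (hΩ : IsOpen Ω) {A : Set (Euc n)} (hA : MeasurableSet A) :
    MeasurableSet (Ω ∩ φ ⁻¹' A) := by
  have h1 : Measurable (Ω.domRestrict φ) := (continuousOn_iff_continuous_domRestrict.1 hφ.2.1).measurable
  have h2 := hΩ.measurableSet.subtype_image (h1 hA)
  rwa [show Subtype.val '' (Ω.domRestrict φ ⁻¹' A) = Ω ∩ φ ⁻¹' A from by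
    rw [← Subtype.image_preimage_val]; rfl] at h2

lemma IsCompOpBddWith.volume_inter_preimage_of_isCompact {n : ℕ} (hn : 2 ≤ n)
    {Ω Ω' : Set (Euc n)} (hΩ : IsOpen Ω) (hΩ' : IsOpen Ω') {φ : Euc n → Euc n}
    (hφ : IsHomeoOn φ Ω Ω') {q : ℝ} (hq : 1 ≤ q) {K : ℝ≥0∞} (hK : K ≠ ∞)
    (h : IsCompOpBddWith Ω Ω' φ (n : ℝ≥0∞) (ENNReal.ofReal q) K)
    {D : Euc n → Euc n →L[ℝ] Euc n} (hD : HasWeakDerivOn φ D Ω) {A : Set (Euc n)}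
    (hA : IsCompact A) (hAΩ : A ⊆ Ω') (hA0 : volume A = 0) :
    volume (Ω ∩ φ ⁻¹' A) = 0 := by
  obtain ⟨s, hs, hns⟩ : ∃ s : ℝ, 1 < s ∧ 1 / (n : ℝ) + 1 / s = 1 := by
    have hn1 : (1 : ℝ) < n := by exact_mod_cast hn
    have := Real.HolderConjugate.conjExponent hn1
    exact ⟨_, this.symm.lt, by simpa using this.inv_add_inv_eq_one⟩
  have hs0 : 0 < s := by linarith
  obtain ⟨δ, hδ, hδΩ⟩ := hA.exists_cthickening_subset_open hΩ' hAΩ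
  set P := cthickening δ A with hP
  have hPc : IsCompact P := hA.cthickening
  obtain ⟨d, hd, hdB, hdW⟩ := h.exists_density hn hΩ hφ hq hK hD hPc hδΩ hs hns
  obtain ⟨C, hC, hball⟩ := h.exists_volume_preimage_ball_le hn hΩ hφ hq hD hs hns
  set W := cthickening (δ / 2) A with hW
  have hWP : W ⊆ interior P :=
    (cthickening_subset_thickening' hδ (by linarith) A).trans
      (thickening_subset_interior_cthickening δ A)
  have hWm : MeasurableSet W := isClosed_cthickening.measurableSet
  set τ := (volume.restrict W).withDensity fun y => d y ^ s with hτ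
  have hτf : IsFiniteMeasure τ := isFiniteMeasure_withDensity (hdW W hA.cthickening hWP)
  have hQ := hφ.isCompact_inter_preimage hPc hδΩ
  have hφμ : AEMeasurable φ (volume.restrict (Ω ∩ φ ⁻¹' P)) :=
    (hφ.2.1.mono inter_subset_left).aemeasurable hQ.measurableSet
  have hμ : ∀ B, MeasurableSet B → B ⊆ P →
      (volume.restrict (Ω ∩ φ ⁻¹' P)).map φ B = volume (Ω ∩ φ ⁻¹' B) := fun B hB hBP => by
    rw [Measure.map_apply_of_aemeasurable hφμ hB, Measure.restrict_apply' hQ.measurableSet]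
    congr 1
    ext x
    exact ⟨fun hx => ⟨hx.2.1, hx.1⟩, fun hx => ⟨hx.2, hx.1, hBP hx.2⟩⟩
  have hfin : IsFiniteMeasure (volume.restrict (Ω ∩ φ ⁻¹' P)) :=
    isFiniteMeasure_restrict.2 hQ.measure_lt_top.ne
  have hr₀ : 0 < δ / 8 := by positivity
  set c := (2 * volume (ball (0 : Euc n) 1) ^ (1 / (n : ℝ))) ^ s with hc
  have hct : c ≠ ∞ := ENNReal.rpow_ne_top_of_nonneg hs0.le (ENNReal.mul_ne_top (by simp)
    (ENNReal.rpow_ne_top_of_nonneg (by positivity) measure_ball_lt_top.ne))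
  have hτ0 : τ A = 0 := by
    refine withDensity_absolutelyContinuous _ _ ?_
    exact le_antisymm ((Measure.restrict_apply_le _ _).trans hA0.le) zero_le
  rw [← hμ A hA.measurableSet (self_subset_cthickening A)]
  refine measure_eq_zero_of_ball_le hA (ENNReal.mul_ne_top hC hct) hr₀ (fun y hy r hr => ?_) hτ0
  have hyW : closedBall y (2 * r) ⊆ W := fun z hz => by
    obtain ⟨x, hx, hxy⟩ := mem_thickening_iff.1 hy
    refine mem_cthickening_of_dist_le z x _ A hx ?_
    have := dist_triangle z y x
    rw [mem_closedBall] at hz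
    linarith [hr.2]
  have hyP := hyW.trans (hWP.trans interior_subset)
  rw [hμ _ measurableSet_ball (((ball_subset_ball (by linarith [hr.1])).trans
    ball_subset_closedBall).trans hyP)]
  refine (hball y r hr.1 (hyP.trans hδΩ)).trans ?_
  rw [mul_assoc, hdB _ measurableSet_closedBall (hyW.trans hWP), hτ,
    withDensity_apply _ measurableSet_closedBall, Measure.restrict_restrict measurableSet_closedBall,
    inter_eq_self_of_subset_left hyW]
  exact mul_le_mul' le_rfl (rpow_inv_mul_lintegral_closedBall_le hn hd hs hns y hr.1)

lemma IsCompOpBddWith.volume_inter_preimage_eq_zero {n : ℕ} (hn : 2 ≤ n)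
    {Ω Ω' : Set (Euc n)} (hΩ : IsOpen Ω) (hΩ' : IsOpen Ω') {φ : Euc n → Euc n}
    (hφ : IsHomeoOn φ Ω Ω') {q : ℝ} (hq : 1 ≤ q) {K : ℝ≥0∞} (hK : K ≠ ∞)
    (h : IsCompOpBddWith Ω Ω' φ (n : ℝ≥0∞) (ENNReal.ofReal q) K)
    {D : Euc n → Euc n →L[ℝ] Euc n} (hD : HasWeakDerivOn φ D Ω) {A : Set (Euc n)}
    (hA0 : volume A = 0) : volume (Ω ∩ φ ⁻¹' A) = 0 := by
  have hm := hφ.measurableSet_inter_preimage hΩ (measurableSet_toMeasurable volume A)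
  refine measure_mono_null (inter_subset_inter_right _ (preimage_mono
    (subset_toMeasurable volume A))) ?_
  rw [hm.measure_eq_iSup_isCompact]
  refine le_antisymm (iSup₂_le fun F hF => iSup_le fun hFc => ?_) zero_le
  have hFΩ : F ⊆ Ω := hF.trans inter_subset_left
  refine (measure_mono (t := Ω ∩ φ ⁻¹' (φ '' F)) (subset_inter hFΩ (subset_preimage_image φ F))
    ).trans (h.volume_inter_preimage_of_isCompact hn hΩ hΩ' hφ hq hK hD
      (hFc.image_of_continuousOn (hφ.2.1.mono hFΩ)) ?_ ?_).le
  · exact (image_mono hFΩ).trans hφ.1.mapsTo.image_subset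
  · refine measure_mono_null (image_subset_iff.2 (hF.trans inter_subset_right)) ?_
    rwa [measure_toMeasurable]

lemma ofReal_abs_det_le {n : ℕ} (T : Euc n →L[ℝ] Euc n) :
    ENNReal.ofReal |T.det| ≤ ‖T‖ₑ ^ (n : ℝ) := by
  have hB := measure_ball_pos volume (0 : Euc n) one_pos
  have hBt : volume (ball (0 : Euc n) 1) ≠ ∞ := measure_ball_lt_top.ne
  refine (ENNReal.mul_le_mul_iff_left hB.ne' hBt).1 ?_
  have h2 : T '' ball 0 1 ⊆ closedBall 0 ‖T‖ := by
    rintro _ ⟨x, hx, rfl⟩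
    rw [mem_closedBall_zero_iff]
    refine (T.le_opNorm x).trans (mul_le_of_le_one_right (norm_nonneg _) ?_)
    exact (mem_ball_zero_iff.1 hx).le
  rw [← Measure.addHaar_image_continuousLinearMap]
  refine (measure_mono h2).trans_eq ?_
  rw [Measure.addHaar_closedBall _ _ (norm_nonneg _), finrank_euclideanSpace, Fintype.card_fin,
    ENNReal.ofReal_pow (norm_nonneg _), ofReal_norm, ENNReal.rpow_natCast]

lemma ENNReal.one_le_mul_rpow_div_rpow {a j : ℝ≥0∞} {n q : ℝ} (hq : 0 < q) (hqn : q < n)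
    (ha : a ≠ ∞) (hj : j ≠ 0) (hja : j ≤ a ^ n) :
    1 ≤ j * ((a ^ q / j) ^ (1 / q)) ^ (n * q / (n - q)) := by
  have hn : 0 < n := hq.trans hqn
  have hnq : 0 < n - q := sub_pos.2 hqn
  have hjt : j ≠ ∞ := ne_top_of_le_ne_top (ENNReal.rpow_ne_top_of_nonneg hn.le ha) hja
  have h1 : j ^ (q / n) ≤ a ^ q := by
    calc j ^ (q / n) ≤ (a ^ n) ^ (q / n) := by gcongr
      _ = a ^ q := by rw [← ENNReal.rpow_mul, mul_div_cancel₀ _ hn.ne']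
  have h2 : j ^ (q / n - 1) ≤ a ^ q / j := by
    rw [ENNReal.rpow_sub _ _ hj hjt, ENNReal.rpow_one]
    gcongr
  rw [← ENNReal.rpow_mul]
  calc (1 : ℝ≥0∞) = j * (j ^ (q / n - 1)) ^ (1 / q * (n * q / (n - q))) := by
        rw [← ENNReal.rpow_mul]
        have : (q / n - 1) * (1 / q * (n * q / (n - q))) = -1 := by
          field_simp
          ring
        rw [this, ENNReal.rpow_neg_one, ENNReal.mul_inv_cancel hj hjt]
    _ ≤ _ := by gcongr

lemma volume_le_setLIntegral_image {n : ℕ} {φ : Euc n → Euc n}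
    {D : Euc n → Euc n →L[ℝ] Euc n} {F : Set (Euc n)} (hF : MeasurableSet F)
    (hD : ∀ x ∈ F, HasFDerivWithinAt φ (D x) F x) (hinj : InjOn φ F) {H : Euc n → ℝ≥0∞}
    (hH : ∀ x ∈ F, 1 ≤ ENNReal.ofReal |(D x).det| * H (φ x)) :
    volume F ≤ ∫⁻ y in φ '' F, H y := by
  rw [lintegral_image_eq_lintegral_abs_det_fderiv_mul volume hF hD hinj, ← setLIntegral_one]
  exact setLIntegral_mono' hF hH

lemma volume_le_setLIntegral_of_cover {n : ℕ} {φ : Euc n → Euc n}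
    {D : Euc n → Euc n →L[ℝ] Euc n} {F A : Set (Euc n)} (hF : MeasurableSet F)
    {E : ℕ → Set (Euc n)} (hE : ∀ k, MeasurableSet (E k))
    (hED : ∀ k, ∀ x ∈ E k, HasFDerivWithinAt φ (D x) (E k) x) (hFE : F ⊆ ⋃ k, E k)
    (hinj : InjOn φ F) (hFA : MapsTo φ F A) {H : Euc n → ℝ≥0∞}
    (hH : ∀ x ∈ F, 1 ≤ ENNReal.ofReal |(D x).det| * H (φ x)) :
    volume F ≤ ∫⁻ y in A, H y := by
  set G : ℕ → Set (Euc n) := fun k => F ∩ disjointed E k with hG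
  have hGF : ∀ k, G k ⊆ F := fun k => inter_subset_left
  have hGm : ∀ k, MeasurableSet (G k) := fun k => hF.inter (MeasurableSet.disjointed hE k)
  have hGD : ∀ k, ∀ x ∈ G k, HasFDerivWithinAt φ (D x) (G k) x := fun k x hx =>
    have hsub : G k ⊆ E k := inter_subset_right.trans (disjointed_subset E k)
    (hED k x (hsub hx)).mono hsub
  have hdisj : Pairwise (Function.onFun Disjoint fun k => φ '' G k) := fun k l hkl => by
    refine disjoint_image_image fun x hx y hy hxy => ?_
    have := hinj (hGF k hx) (hGF l hy) hxy
    subst this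
    exact disjoint_left.1 (disjoint_disjointed E hkl) hx.2 hy.2
  calc volume F = volume (⋃ k, G k) := by
        rw [hG, ← inter_iUnion, iUnion_disjointed, inter_eq_self_of_subset_left hFE]
    _ ≤ ∑' k, volume (G k) := measure_iUnion_le _
    _ ≤ ∑' k, ∫⁻ y in φ '' G k, H y := ENNReal.tsum_le_tsum fun k =>
        volume_le_setLIntegral_image (hGm k) (hGD k) (hinj.mono (hGF k)) fun x hx =>
          hH x (hGF k hx)
    _ = ∫⁻ y in ⋃ k, φ '' G k, H y := (lintegral_iUnion (fun k =>
        measurable_image_of_fderivWithin (hGm k) (hGD k) (hinj.mono (hGF k))) hdisj _).symm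
    _ ≤ ∫⁻ y in A, H y := lintegral_mono_set (iUnion_subset fun k =>
        (hFA.mono_left (hGF k)).image_subset)

theorem statement_6 (n : ℕ) (hn : 2 ≤ n) (Ω Ω' : Set (Euc n))
    (hΩ : IsDomainIn Ω) (hΩ' : IsDomainIn Ω')
    (q : ℝ) (hq : 1 ≤ q) (hqn : q < n)
    (φ : Euc n → Euc n) (hφ : IsHomeoOn φ Ω Ω')
    (hcomp : IsCompOpBdd Ω Ω' φ (n : ℝ≥0∞) (ENNReal.ofReal q)) :
    ∃ (D : Euc n → Euc n →L[ℝ] Euc n) (S : Set (Euc n)) (C : ℝ≥0∞),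
      HasWeakDerivOn φ D Ω ∧ volume S = 0 ∧ C ≠ ∞ ∧
      ∀ A : Set (Euc n), A ⊆ Ω' → MeasurableSet A →
        volume (Ω ∩ φ ⁻¹' A) ≤
          C * ∫⁻ y in A, distortionH D φ Ω S q y ^ ((n : ℝ) * q / ((n : ℝ) - q)) := by
  obtain ⟨K, hK, h⟩ := hcomp
  obtain ⟨D, hD⟩ := h.exists_hasWeakDerivOn hn hΩ.1 hφ.2.1 hq
  obtain ⟨E, hE, hEΩ, hE0, hED⟩ := exists_countable_cover_hasFDerivWithinAt hΩ.1 hD hφ.2.1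
  have hZk : ∀ k, volume (E k ∩ {x | jacobian D x = 0}) = 0 := fun k => by
    refine measure_mono_null (t := Ω ∩ φ ⁻¹' (φ '' (E k ∩ {x | jacobian D x = 0})))
      (subset_inter (inter_subset_left.trans (hEΩ k)) (subset_preimage_image _ _))
      (h.volume_inter_preimage_eq_zero hn hΩ.1 hΩ'.1 hφ hq hK hD ?_)
    exact addHaar_image_eq_zero_of_det_fderivWithin_eq_zero volume
      (fun x hx => (hED k x hx.1).mono inter_subset_left) fun x hx => hx.2
  set N : Set (Euc n) := (Ω \ ⋃ k, E k) ∪ ⋃ k, E k ∩ {x | jacobian D x = 0} with hN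
  have hN0 : volume N = 0 := measure_union_null hE0 (measure_iUnion_null hZk)
  set S := toMeasurable volume N with hS
  have hS0 : volume S = 0 := by rwa [hS, measure_toMeasurable]
  refine ⟨D, S, 1, hD, hS0, ENNReal.one_ne_top, fun A hA hAm => ?_⟩
  rw [one_mul]
  set F := (Ω ∩ φ ⁻¹' A) \ S with hF
  have hFm : MeasurableSet F :=
    (hφ.measurableSet_inter_preimage hΩ.1 hAm).diff (measurableSet_toMeasurable _ _)
  have hNS : N ⊆ S := subset_toMeasurable volume N
  have hFE : F ⊆ ⋃ k, E k := fun x hx => by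
    by_contra hxE
    exact hx.2 (hNS (Or.inl ⟨hx.1.1, hxE⟩))
  have hFJ : ∀ x ∈ F, jacobian D x ≠ 0 := fun x hx hJ => by
    obtain ⟨k, hk⟩ := mem_iUnion.1 (hFE hx)
    exact hx.2 (hNS (Or.inr (mem_iUnion.2 ⟨k, hk, hJ⟩)))
  calc volume (Ω ∩ φ ⁻¹' A) = volume F := (measure_sdiff_null hS0).symm
    _ ≤ _ := volume_le_setLIntegral_of_cover hFm hE hED hFE
      (hφ.1.injOn.mono fun x hx => hx.1.1) (fun x hx => hx.1.2) fun x hx => ?_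
  have hinv : Function.invFunOn φ Ω (φ x) = x := hφ.1.invOn_invFunOn.1 hx.1.1
  rw [distortionH, hinv, if_pos ⟨hx.1.1, fun h => h.elim hx.2 (hFJ x hx)⟩]
  exact ENNReal.one_le_mul_rpow_div_rpow (by linarith) hqn enorm_ne_top
    (ENNReal.ofReal_pos.2 (abs_pos.2 (hFJ x hx))).ne' (ofReal_abs_det_le (D x))
end
end
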